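/- arXiv:2002.04305 — 7 statements merged into one kernel-verified Lean document; each statement's English description precedes it below -/
import Mathlib

section
/- In the CQ setting described in the context, for every n ∈ ℕ one has F ⊆ C_n ∩ Q_n; in particular, each C_n ∩ Q_n is a nonempty closed convex subset of C, so the iteration is well defined. -/
open Filter Topology

noncomputable section

open scoped Classical

/-- The spherical metric on the unit sphere of a real Hilbert space:
`d(x,y) = arccos ⟨x,y⟩`. -/
def sphDist {H : Type*} [NormedAddCommGroup H] [InnerProductSpace ℝ H]
    (x y : H) : ℝ :=
  Real.arccos (@inner ℝ H _ x y)

/-- The geodesic combination `t x ⊕ (1-t) y` on the unit sphere: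
for `x ≠ y` it is `(sin(tθ)/sin θ) • x + (sin((1-t)θ)/sin θ) • y` with `θ = d(x,y)`,
and `t x ⊕ (1-t) x = x`. -/
def geo {H : Type*} [NormedAddCommGroup H] [InnerProductSpace ℝ H]
    (t : ℝ) (x y : H) : H :=
  if x = y then x
  else (Real.sin (t * sphDist x y) / Real.sin (sphDist x y)) • x +
    (Real.sin ((1 - t) * sphDist x y) / Real.sin (sphDist x y)) • y

/-- Convexity of a subset of the unit sphere with respect to geodesic combinations. -/
def SphConvex {H : Type*} [NormedAddCommGroup H] [InnerProductSpace ℝ H]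
    (C : Set H) : Prop :=
  ∀ v ∈ C, ∀ v' ∈ C, ∀ t ∈ Set.Icc (0 : ℝ) 1, geo t v v' ∈ C

/-- The mappings `U_i` generating the `W`-mapping: `U_0 = I`,
`U_i x = α_i (T_i (U_{i-1} x)) ⊕ (1 - α_i) x`.  The `W`-mapping generated by
`T_1, …, T_r` and `α_1, …, α_r` is `W = Uiter T α r`. -/
def Uiter {H : Type*} [NormedAddCommGroup H] [InnerProductSpace ℝ H]
    (T : ℕ → H → H) (α : ℕ → ℝ) : ℕ → H → H
  | 0 => id
  | (i + 1) => fun x => geo (α (i + 1)) (T (i + 1) (Uiter T α i x)) x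



lemma aux_inner_le_one {H : Type*} [NormedAddCommGroup H] [InnerProductSpace ℝ H]
    {u v : H} (hu : ‖u‖ = 1) (hv : ‖v‖ = 1) : (inner ℝ (u) (v)) ≤ 1 := by
  have := real_inner_le_norm u v
  rw [hu, hv] at this; linarith

lemma aux_neg_one_le {H : Type*} [NormedAddCommGroup H] [InnerProductSpace ℝ H]
    {u v : H} (hu : ‖u‖ = 1) (hv : ‖v‖ = 1) : -1 ≤ (inner ℝ (u) (v)) := by
  have := abs_real_inner_le_norm u v
  rw [hu, hv] at this
  have := (abs_le.mp this).1; linarith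

lemma aux_cos {H : Type*} [NormedAddCommGroup H] [InnerProductSpace ℝ H]
    {u v : H} (hu : ‖u‖ = 1) (hv : ‖v‖ = 1) : Real.cos (sphDist u v) = (inner ℝ (u) (v)) :=
  Real.cos_arccos (aux_neg_one_le hu hv) (aux_inner_le_one hu hv)

lemma aux_le_iff {H : Type*} [NormedAddCommGroup H] [InnerProductSpace ℝ H]
    {u v w : H} (hu : ‖u‖ = 1) (hv : ‖v‖ = 1) (hw : ‖w‖ = 1) :
    sphDist u w ≤ sphDist v w ↔ (inner ℝ (v) (w)) ≤ (inner ℝ (u) (w)) := by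
  constructor
  · intro h
    rw [← aux_cos hu hw, ← aux_cos hv hw]
    exact Real.cos_le_cos_of_nonneg_of_le_pi (Real.arccos_nonneg _) (Real.arccos_le_pi _) h
  · intro h
    exact Real.arccos_le_arccos h

lemma aux_pos_dist {H : Type*} [NormedAddCommGroup H] [InnerProductSpace ℝ H]
    {u v : H} (hu : ‖u‖ = 1) (hv : ‖v‖ = 1) (hne : u ≠ v) : 0 < sphDist u v := by
  refine Real.arccos_pos.mpr ?_
  refine lt_of_le_of_ne (aux_inner_le_one hu hv) fun h => hne ?_
  exact (inner_eq_one_iff_of_norm_eq_one hu hv).mp h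

/-- coefficient form of `geo`. -/
lemma aux_geo {H : Type*} [NormedAddCommGroup H] [InnerProductSpace ℝ H]
    {u v : H} (hu : ‖u‖ = 1) (hv : ‖v‖ = 1) (hd : sphDist u v < Real.pi / 2)
    {t : ℝ} (ht : t ∈ Set.Icc (0 : ℝ) 1) :
    ∃ A B : ℝ, 0 ≤ A ∧ 0 ≤ B ∧ 1 ≤ A + B ∧ geo t u v = A • u + B • v := by
  by_cases huv : u = v
  · exact ⟨1, 0, by norm_num, by norm_num, by norm_num, by simp [geo, huv]⟩
  · have hθ := aux_pos_dist hu hv huv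
    obtain ⟨ht0, ht1⟩ := ht
    set θ := sphDist u v with hθd
    have hpi := Real.pi_pos
    have hs : 0 < Real.sin θ := Real.sin_pos_of_pos_of_lt_pi hθ (by linarith)
    have h1 : 0 ≤ Real.sin (t * θ) :=
      Real.sin_nonneg_of_nonneg_of_le_pi (by positivity) (by nlinarith)
    have h2 : 0 ≤ Real.sin ((1 - t) * θ) :=
      Real.sin_nonneg_of_nonneg_of_le_pi (mul_nonneg (by linarith) hθ.le) (by nlinarith)
    refine ⟨_, _, div_nonneg h1 hs.le, div_nonneg h2 hs.le, ?_, by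
      simp only [geo, if_neg huv, ← hθd]⟩
    rw [← add_div, le_div_iff₀ hs, one_mul]
    have e : Real.sin θ = Real.sin (t * θ + (1 - t) * θ) := by ring_nf
    rw [e, Real.sin_add]
    nlinarith [Real.cos_le_one (t * θ), Real.cos_le_one ((1 - t) * θ)]

/-- the projection inequality. -/
lemma aux_proj {H : Type*} [NormedAddCommGroup H] [InnerProductSpace ℝ H]
    {w p z : H} (hw : ‖w‖ = 1) (hp : ‖p‖ = 1) (hz : ‖z‖ = 1)
    (hd : sphDist z p < Real.pi / 2) (hc : 0 ≤ (inner ℝ (w) (p)))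
    (h : ∀ t ∈ Set.Icc (0 : ℝ) 1, (inner ℝ (w) (geo t z p)) ≤ (inner ℝ (w) (p))) :
    (inner ℝ (w) (z)) ≤ (inner ℝ (w) (p)) * (inner ℝ (p) (z)) := by
  by_cases hzp : z = p
  · subst hzp
    simp [real_inner_self_eq_norm_sq, hz]
  have hθ := aux_pos_dist hz hp hzp
  have hcos := aux_cos hz hp
  rw [real_inner_comm z p] at *
  have hc1 := aux_inner_le_one hw hp
  set θ := sphDist z p with hθd
  have hpi := Real.pi_pos
  have hs : 0 < Real.sin θ := Real.sin_pos_of_pos_of_lt_pi hθ (by linarith)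
  rw [← hcos]
  by_contra! hcon
  set δ := (inner ℝ (w) (z)) - (inner ℝ (w) (p)) * Real.cos θ with hδ
  have hδ0 : 0 < δ := by linarith
  obtain ⟨s, hs0, hsθ, hsδ⟩ : ∃ s, 0 < s ∧ s ≤ θ ∧ s < δ :=
    ⟨min θ (δ / 2), lt_min hθ (by linarith), min_le_left _ _,
      (min_le_right _ _).trans_lt (by linarith)⟩
  have key := h (s / θ) ⟨by positivity, (div_le_one hθ).mpr hsθ⟩
  have e1 : s / θ * θ = s := by field_simp
  have e2 : (1 - s / θ) * θ = θ - s := by field_simp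
  simp only [geo, if_neg hzp, ← hθd, e1, e2, inner_add_right, inner_smul_right] at key
  rw [div_mul_eq_mul_div, div_mul_eq_mul_div, ← add_div, div_le_iff₀ hs, Real.sin_sub] at key
  have hss : 0 < Real.sin s := Real.sin_pos_of_pos_of_lt_pi hs0 (by linarith)
  have hcs : 0 ≤ Real.cos s := Real.cos_nonneg_of_neg_pi_div_two_le_of_le (by linarith) (by linarith)
  have hsl := Real.sin_lt hs0
  have hsq := Real.sin_sq_add_cos_sq s
  have hle : 1 - Real.cos s ≤ Real.sin s ^ 2 := by nlinarith [Real.cos_le_one s]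
  have hb : (inner ℝ (w) (p)) * Real.sin θ ≤ 1 := mul_le_one₀ hc1 hs.le (Real.sin_le_one θ)
  have k1 : δ * Real.sin s ≤ (inner ℝ (w) (p)) * Real.sin θ * (1 - Real.cos s) := by
    rw [hδ]; linarith
  have k2 : (inner ℝ (w) (p)) * Real.sin θ * (1 - Real.cos s) ≤ 1 * Real.sin s ^ 2 :=
    mul_le_mul hb hle (by linarith [Real.cos_le_one s]) (by norm_num)
  have k3 : δ ≤ Real.sin s := by
    by_contra! hh
    nlinarith
  linarith

/-- In the CQ setting, `F ⊆ C_n ∩ Q_n` for every `n`; in particular each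
`C_n ∩ Q_n` is a nonempty closed convex subset of `C`, so the iteration is
well defined. -/
theorem cq_F_subset_CnQn
    {H : Type*} [NormedAddCommGroup H] [InnerProductSpace ℝ H]
    -- `C` is a nonempty closed convex subset of the unit sphere `S_H`
    (C : Set H) (hCsphere : ∀ v ∈ C, ‖v‖ = 1)
    (hCne : C.Nonempty) (hCclosed : IsClosed C) (hCconv : SphConvex C)
    (hCdiam : ∀ v ∈ C, ∀ v' ∈ C, sphDist v v' < Real.pi / 2)
    (a : ℝ) (ha0 : 0 < a) (ha1 : a < 1 / 2)
    (r : ℕ) (hr : 1 ≤ r)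
    (α : ℕ → ℕ → ℝ)
    (hα : ∀ n, 1 ≤ n → ∀ i, 1 ≤ i → i ≤ r → α n i ∈ Set.Icc a (1 - a))
    -- `T_1, …, T_r` are nonexpansive self-mappings of `C`
    (T : ℕ → H → H)
    (hTmaps : ∀ i, 1 ≤ i → i ≤ r → ∀ v ∈ C, T i v ∈ C)
    (hTnonexp : ∀ i, 1 ≤ i → i ≤ r → ∀ v ∈ C, ∀ v' ∈ C,
      sphDist (T i v) (T i v') ≤ sphDist v v')
    -- `F := ⋂ᵢ F(Tᵢ) ≠ ∅`
    (F : Set H)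
    (hF : F = ⋂ i ∈ Finset.Icc 1 r, {z ∈ C | T i z = z})
    (hFne : F.Nonempty)
    -- the CQ iteration: `y_n = W_n x_n`, `x_{n+1} = P_{C_n ∩ Q_n} x_1`
    (x y : ℕ → H) (hx1 : x 1 ∈ C)
    (hy : ∀ n, y n = Uiter T (α n) r (x n))
    (CS QS : ℕ → Set H)
    (hCS : ∀ n, CS n = {z ∈ C | sphDist (y n) z ≤ sphDist (x n) z})
    (hQS : ∀ n, QS n = {z ∈ C |
      Real.cos (sphDist (x 1) z) ≤
        Real.cos (sphDist (x 1) (x n)) * Real.cos (sphDist (x n) z)})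
    (hxmem : ∀ n, 1 ≤ n → x (n + 1) ∈ CS n ∩ QS n)
    (hxproj : ∀ n, 1 ≤ n → ∀ z ∈ CS n ∩ QS n,
      sphDist (x 1) (x (n + 1)) ≤ sphDist (x 1) z)
    :
    ∀ n, 1 ≤ n →
      F ⊆ CS n ∩ QS n ∧ (CS n ∩ QS n).Nonempty ∧ (CS n ∩ QS n) ⊆ C ∧
        IsClosed (CS n ∩ QS n) ∧ SphConvex (CS n ∩ QS n) := by

  have hpos : ∀ v ∈ C, ∀ v' ∈ C, 0 < (inner ℝ (v) (v')) := fun v hv v' hv' =>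
    Real.arccos_lt_pi_div_two.mp (hCdiam v hv v' hv')
  have hFC : ∀ z ∈ F, z ∈ C ∧ ∀ i, 1 ≤ i → i ≤ r → T i z = z := by
    intro z hz
    rw [hF] at hz
    simp only [Set.mem_iInter, Finset.mem_Icc, Set.mem_setOf_eq] at hz
    exact ⟨(hz 1 ⟨le_rfl, hr⟩).1, fun i h1 h2 => (hz i ⟨h1, h2⟩).2⟩
  have hxC : ∀ n, 1 ≤ n → x n ∈ C := by
    intro n hn
    obtain ⟨m, rfl⟩ : ∃ m, n = m + 1 := ⟨n - 1, by omega⟩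
    rcases Nat.eq_zero_or_pos m with rfl | hm
    · exact hx1
    · have := (hxmem m hm).1
      rw [hCS] at this
      exact this.1
  have hα01 : ∀ n, 1 ≤ n → ∀ i, 1 ≤ i → i ≤ r → α n i ∈ Set.Icc (0 : ℝ) 1 := by
    intro n hn i h1 h2
    have := hα n hn i h1 h2
    exact ⟨by linarith [this.1], by linarith [this.2]⟩
  have hU : ∀ n, 1 ≤ n → ∀ i, i ≤ r → Uiter T (α n) i (x n) ∈ C ∧
      ∀ z ∈ F, (inner ℝ (x n) (z)) ≤ (inner ℝ (Uiter T (α n) i (x n)) (z)) := by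
    intro n hn i
    have hxn := hxC n hn
    induction i with
    | zero => intro _; exact ⟨hxn, fun z _ => le_rfl⟩
    | succ i ih =>
      intro hi
      obtain ⟨hUC, hUz⟩ := ih (by omega)
      have hTC := hTmaps (i + 1) (by omega) hi _ hUC
      have ht := hα01 n hn (i + 1) (by omega) hi
      refine ⟨hCconv _ hTC _ hxn _ ht, fun z hz => ?_⟩
      obtain ⟨hzC, hzT⟩ := hFC z hz
      have hne := hTnonexp (i + 1) (by omega) hi _ hUC z hzC
      rw [hzT (i + 1) (by omega) hi,
        aux_le_iff (hCsphere _ hTC) (hCsphere _ hUC) (hCsphere _ hzC)] at hne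
      obtain ⟨A, B, hA, hB, hAB, hg⟩ := aux_geo (hCsphere _ hTC) (hCsphere _ hxn)
        (hCdiam _ hTC _ hxn) ht
      simp only [Uiter]
      rw [hg, inner_add_left, real_inner_smul_left, real_inner_smul_left]
      have h1 := hUz z hz
      have h0 := hpos _ hxn _ hzC
      nlinarith [mul_le_mul_of_nonneg_left (h1.trans hne) hA]
  have hyC : ∀ n, 1 ≤ n → y n ∈ C := fun n hn => by
    rw [hy]; exact (hU n hn r le_rfl).1
  -- half-space description
  have hK : ∀ n, 1 ≤ n → CS n ∩ QS n = C ∩ {z | 0 ≤ (inner ℝ (y n - x n) (z))} ∩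
      {z | 0 ≤ (inner ℝ (((inner ℝ (x 1) (x n))) • x n - x 1) (z))} := by
    intro n hn
    have hxn := hCsphere _ (hxC n hn)
    have hyn := hCsphere _ (hyC n hn)
    have h1 := hCsphere _ hx1
    ext z
    rw [hCS, hQS]
    simp only [Set.mem_inter_iff, Set.mem_setOf_eq, inner_sub_left, real_inner_smul_left,
      sub_nonneg]
    constructor
    · rintro ⟨⟨hz, ha⟩, -, hb⟩
      have hz1 := hCsphere _ hz
      rw [aux_le_iff hyn hxn hz1] at ha
      rw [aux_cos h1 hz1, aux_cos h1 hxn, aux_cos hxn hz1] at hb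
      exact ⟨⟨hz, ha⟩, hb⟩
    · rintro ⟨⟨hz, ha⟩, hb⟩
      have hz1 := hCsphere _ hz
      rw [aux_le_iff hyn hxn hz1, aux_cos h1 hz1, aux_cos h1 hxn, aux_cos hxn hz1]
      exact ⟨⟨hz, ha⟩, hz, hb⟩
  have hconv : ∀ n, 1 ≤ n → SphConvex (CS n ∩ QS n) := by
    intro n hn
    rw [hK n hn]
    rintro u ⟨⟨huC, hu1⟩, hu2⟩ v ⟨⟨hvC, hv1⟩, hv2⟩ t ht
    obtain ⟨A, B, hA, hB, -, hg⟩ := aux_geo (hCsphere _ huC) (hCsphere _ hvC)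
        (hCdiam _ huC _ hvC) ht
    refine ⟨⟨hCconv _ huC _ hvC _ ht, ?_⟩, ?_⟩
    · simp only [Set.mem_setOf_eq] at hu1 hv1 ⊢
      rw [hg, inner_add_right, real_inner_smul_right, real_inner_smul_right]
      positivity
    · simp only [Set.mem_setOf_eq] at hu2 hv2 ⊢
      rw [hg, inner_add_right, real_inner_smul_right, real_inner_smul_right]
      positivity
  have hclosed : ∀ n, 1 ≤ n → IsClosed (CS n ∩ QS n) := by
    intro n hn
    rw [hK n hn]
    exact (hCclosed.inter (isClosed_le continuous_const (by fun_prop))).inter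
      (isClosed_le continuous_const (by fun_prop))
  have hsub : ∀ n, CS n ∩ QS n ⊆ C := by
    intro n z hz
    have := hz.1
    rw [hCS] at this
    exact this.1
  have hmain : ∀ n, 1 ≤ n → F ⊆ CS n ∩ QS n := by
    intro n hn
    induction n, hn using Nat.le_induction with
    | base =>
      intro z hz
      obtain ⟨hzC, -⟩ := hFC z hz
      rw [hK 1 le_rfl]
      refine ⟨⟨hzC, ?_⟩, ?_⟩
      · simp only [Set.mem_setOf_eq, inner_sub_left, sub_nonneg]
        rw [hy]; exact (hU 1 le_rfl r le_rfl).2 z hz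
      · simp [real_inner_self_eq_norm_sq, hCsphere _ hx1]
    | succ n hn ih =>
      intro z hz
      obtain ⟨hzC, -⟩ := hFC z hz
      have hxs := hxC (n + 1) (by omega)
      rw [hK (n + 1) (by omega)]
      refine ⟨⟨hzC, ?_⟩, ?_⟩
      · simp only [Set.mem_setOf_eq, inner_sub_left, sub_nonneg]
        rw [hy]; exact (hU (n + 1) (by omega) r le_rfl).2 z hz
      · simp only [Set.mem_setOf_eq, inner_sub_left, sub_nonneg, real_inner_smul_left]
        refine aux_proj (hCsphere _ hx1) (hCsphere _ hxs) (hCsphere _ hzC)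
          (hCdiam _ hzC _ hxs) (hpos _ hx1 _ hxs).le fun t ht => ?_
        have hg := hconv n hn _ (ih hz) _ (hxmem n hn) t ht
        have hgC := hsub n hg
        have := hxproj n hn _ hg
        rw [← aux_cos (hCsphere _ hx1) (hCsphere _ hgC),
          ← aux_cos (hCsphere _ hx1) (hCsphere _ hxs)]
        exact Real.cos_le_cos_of_nonneg_of_le_pi (Real.arccos_nonneg _) (Real.arccos_le_pi _) this
  exact fun n hn => ⟨hmain n hn, hFne.mono (hmain n hn), hsub n, hclosed n hn, hconv n hn⟩
end
end

section
/- (Variational characterization of metric projections on the Hilbert sphere.) Let K be a nonempty convex subset of the Hilbert sphere S_H, let x_1 ∈ S_H, and suppose d(u,v) < π/2 for all u,v ∈ K ∪ {x_1}. Let p ∈ K satisfy d(x_1,p) ≤ d(x_1,y) for all y ∈ K (i.e., p is a nearest point of K to x_1). Then for every z ∈ K, cos d(x_1,p) · cos d(p,z) ≥ cos d(x_1,z). -/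
open Filter Topology

noncomputable section

open scoped Classical

/-- **Variational characterization of metric projections on the Hilbert
sphere.** If `K` is a nonempty convex subset of `S_H`, `x₁ ∈ S_H`, all distances
among points of `K ∪ {x₁}` are `< π/2`, and `p ∈ K` is a nearest point of `K`
to `x₁`, then `cos d(x₁,p) · cos d(p,z) ≥ cos d(x₁,z)` for every `z ∈ K`. -/
theorem sphere_projection_variational_inequality
    {H : Type*} [NormedAddCommGroup H] [InnerProductSpace ℝ H]
    (K : Set H) (hKsphere : ∀ v ∈ K, ‖v‖ = 1)
    (hKne : K.Nonempty) (hKconv : SphConvex K)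
    (x1 : H) (hx1 : ‖x1‖ = 1)
    (hdiam : ∀ u ∈ K ∪ {x1}, ∀ v ∈ K ∪ {x1}, sphDist u v < Real.pi / 2)
    (p : H) (hpK : p ∈ K)
    (hpmin : ∀ z ∈ K, sphDist x1 p ≤ sphDist x1 z) :
    ∀ z ∈ K,
      Real.cos (sphDist x1 z) ≤ Real.cos (sphDist x1 p) * Real.cos (sphDist p z) := by
  have hcos : ∀ u v : H, ‖u‖ = 1 → ‖v‖ = 1 → Real.cos (sphDist u v) = inner ℝ u v := by
    intro u v hu hv
    have h := abs_le.1 (abs_real_inner_le_norm u v)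
    rw [hu, hv] at h
    exact Real.cos_arccos (by linarith [h.1]) (by linarith [h.2])
  have hmin : ∀ y ∈ K, inner ℝ x1 y ≤ inner ℝ x1 p := by
    intro y hy
    rw [← hcos x1 y hx1 (hKsphere y hy), ← hcos x1 p hx1 (hKsphere p hpK)]
    exact Real.cos_le_cos_of_nonneg_of_le_pi (Real.arccos_nonneg _) (Real.arccos_le_pi _)
      (hpmin y hy)
  intro z hz
  have hp1 := hKsphere p hpK
  have hz1 := hKsphere z hz
  by_cases hzp : z = p
  · subst hzp
    rw [hcos z z hz1 hz1, real_inner_self_eq_norm_sq, hz1]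
    simp
  have hsymm : sphDist p z = sphDist z p := by
    unfold sphDist
    rw [real_inner_comm]
  rw [hsymm, hcos x1 z hx1 hz1, hcos x1 p hx1 hp1]
  set θ := sphDist z p with hθ
  have hθlt : θ < Real.pi / 2 := hdiam z (Or.inl hz) p (Or.inl hpK)
  have hθ0 : 0 < θ := by
    rcases (Real.arccos_nonneg (inner ℝ z p)).lt_or_eq with h | h
    · exact h
    · exfalso
      have h2 := hcos z p hz1 hp1
      have h3 : sphDist z p = 0 := h.symm
      rw [h3, Real.cos_zero] at h2
      exact hzp ((inner_eq_one_iff_of_norm_eq_one hz1 hp1).1 h2.symm)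
  have hS : 0 < Real.sin θ := Real.sin_pos_of_pos_of_lt_pi hθ0 (by linarith [Real.pi_pos])
  set a : ℝ := inner ℝ x1 p
  set b : ℝ := inner ℝ x1 z
  have key : ∀ r ∈ Set.Ioo (0 : ℝ) (θ / 2),
      Real.cos r * (b - a * Real.cos θ) ≤ a * Real.sin θ * Real.sin r := by
    intro r hr
    have hr0 := hr.1
    have hr1 := hr.2
    have hmem := hKconv z hz p hpK (2 * r / θ)
      ⟨by positivity, by rw [div_le_one hθ0]; linarith⟩
    have h := hmin _ hmem
    have e1 : 2 * r / θ * θ = 2 * r := by field_simp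
    have e2 : (1 - 2 * r / θ) * θ = θ - 2 * r := by field_simp
    rw [geo, if_neg hzp, ← hθ, e1, e2, inner_add_right, inner_smul_right, inner_smul_right] at h
    change Real.sin (2 * r) / Real.sin θ * b + Real.sin (θ - 2 * r) / Real.sin θ * a ≤ a at h
    have h' : Real.sin (2 * r) * b + Real.sin (θ - 2 * r) * a ≤ a * Real.sin θ := by
      rw [← div_le_iff₀ hS]
      calc _ = _ := by ring
        _ ≤ _ := h
    have hc : Real.cos (2 * r) = 1 - 2 * Real.sin r ^ 2 := by
      rw [Real.cos_two_mul]
      linarith [Real.sin_sq_add_cos_sq r]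
    rw [Real.sin_sub, hc, Real.sin_two_mul] at h'
    have hsr : 0 < Real.sin r := Real.sin_pos_of_pos_of_lt_pi hr0 (by linarith [Real.pi_pos])
    refine le_of_mul_le_mul_left ?_ hsr
    linarith
  have t1 : Tendsto (fun r : ℝ => Real.cos r * (b - a * Real.cos θ)) (𝓝[>] 0)
      (𝓝 (Real.cos 0 * (b - a * Real.cos θ))) :=
    ((by fun_prop : Continuous fun r : ℝ => Real.cos r * (b - a * Real.cos θ)).tendsto 0).mono_left
      nhdsWithin_le_nhds
  have t2 : Tendsto (fun r : ℝ => a * Real.sin θ * Real.sin r) (𝓝[>] 0)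
      (𝓝 (a * Real.sin θ * Real.sin 0)) :=
    ((by fun_prop : Continuous fun r : ℝ => a * Real.sin θ * Real.sin r).tendsto 0).mono_left
      nhdsWithin_le_nhds
  have hev : ∀ᶠ r : ℝ in 𝓝[>] 0,
      Real.cos r * (b - a * Real.cos θ) ≤ a * Real.sin θ * Real.sin r :=
    Filter.eventually_of_mem (Ioo_mem_nhdsGT (by linarith)) key
  have hfin := le_of_tendsto_of_tendsto t1 t2 hev
  simp only [Real.cos_zero, Real.sin_zero] at hfin
  linarith
end
end

section
/- In the CQ setting described in the context, the sequence of distances d(x_1,x_n) is nondecreasing in n, and for every p ∈ F and every n ∈ ℕ one has d(x_1,x_n) ≤ d(x_1,p) < π/2; consequently cos d(x_1,x_n) converges to a limit a > 0 as n → ∞. -/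
open Filter Topology

noncomputable section

open scoped Classical

section helpers
variable {H : Type*} [NormedAddCommGroup H] [InnerProductSpace ℝ H]

lemma cos_sphDist {x y : H} (hx : ‖x‖ = 1) (hy : ‖y‖ = 1) :
    Real.cos (sphDist x y) = inner ℝ x y := by
  have h := abs_real_inner_le_norm x y
  rw [hx, hy, mul_one, abs_le] at h
  exact Real.cos_arccos h.1 h.2

lemma inner_le_one' {x y : H} (hx : ‖x‖ = 1) (hy : ‖y‖ = 1) :
    inner ℝ x y ≤ 1 := by
  have h := abs_real_inner_le_norm x y
  rw [hx, hy, mul_one, abs_le] at h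
  exact h.2

lemma sphDist_le_iff {x y z w : H} (hx : ‖x‖ = 1) (hy : ‖y‖ = 1) (hz : ‖z‖ = 1) (hw : ‖w‖ = 1) :
    sphDist x y ≤ sphDist z w ↔ inner ℝ z w ≤ inner ℝ x y := by
  rw [← cos_sphDist hx hy, ← cos_sphDist hz hw]
  exact (Real.strictAntiOn_cos.le_iff_ge
    ⟨Real.arccos_nonneg _, Real.arccos_le_pi _⟩ ⟨Real.arccos_nonneg _, Real.arccos_le_pi _⟩).symm

lemma sin_mul_ge {t θ : ℝ} (ht : t ∈ Set.Icc (0 : ℝ) 1) (hθ : θ ∈ Set.Icc 0 Real.pi) :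
    t * Real.sin θ ≤ Real.sin (t * θ) := by
  have h := strictConcaveOn_sin_Icc.concaveOn.2 hθ
    (⟨le_rfl, Real.pi_pos.le⟩ : (0 : ℝ) ∈ Set.Icc 0 Real.pi) ht.1 (sub_nonneg.2 ht.2) (by ring)
  simpa using h

lemma sphDist_pos {u v : H} (hu : ‖u‖ = 1) (hv : ‖v‖ = 1) (huv : u ≠ v) :
    0 < sphDist u v := by
  have h1 : inner ℝ u v ≠ 1 := fun h => huv ((inner_eq_one_iff_of_norm_eq_one hu hv).1 h)
  exact Real.arccos_pos.2 (lt_of_le_of_ne (inner_le_one' hu hv) h1)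

lemma geo_lower {u v w : H} (hu : ‖u‖ = 1) (hv : ‖v‖ = 1)
    (hd : sphDist u v < Real.pi / 2) {t c : ℝ} (ht : t ∈ Set.Icc (0 : ℝ) 1) (hc : 0 ≤ c)
    (h1 : c ≤ inner ℝ w u) (h2 : c ≤ inner ℝ w v) : c ≤ inner ℝ w (geo t u v) := by
  unfold geo
  split_ifs with h
  · exact h1
  have hp := sphDist_pos hu hv h
  have hpi := Real.pi_pos
  have hI : sphDist u v ∈ Set.Icc 0 Real.pi := ⟨hp.le, by linarith⟩
  have hs : 0 < Real.sin (sphDist u v) := Real.sin_pos_of_pos_of_lt_pi hp (by linarith)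
  have e1 := sin_mul_ge ht hI
  have e2 := sin_mul_ge (t := 1 - t) ⟨by linarith [ht.2], by linarith [ht.1]⟩ hI
  rw [← le_div_iff₀ hs] at e1 e2
  rw [inner_add_right, inner_smul_right, inner_smul_right]
  have a1 := mul_le_mul e1 h1 hc (ht.1.trans e1)
  have a2 := mul_le_mul e2 h2 hc ((sub_nonneg.2 ht.2).trans e2)
  linarith

lemma proj_ineq {p q w : H} (hp : ‖p‖ = 1) (hq : ‖q‖ = 1) (hw : ‖w‖ = 1)
    (hd : sphDist p q < Real.pi / 2) (hA : 0 ≤ inner ℝ w q)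
    (h : ∀ t ∈ Set.Icc (0 : ℝ) 1, inner ℝ w (geo t p q) ≤ inner ℝ w q) :
    inner ℝ w p ≤ inner ℝ w q * inner ℝ q p := by
  by_cases hpq : p = q
  · subst hpq
    simp [real_inner_self_eq_norm_sq, hp]
  have hpi := Real.pi_pos
  have hθ := sphDist_pos hp hq hpq
  have hcos : inner ℝ q p = Real.cos (sphDist p q) := by
    rw [cos_sphDist hp hq, real_inner_comm]
  rw [hcos]
  have hA1 := inner_le_one' hw hq
  simp only [geo, if_neg hpq, inner_add_right, inner_smul_right] at h
  generalize sphDist p q = θ at *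
  generalize (inner ℝ w p : ℝ) = P at *
  generalize (inner ℝ w q : ℝ) = A at *
  have hs : 0 < Real.sin θ := Real.sin_pos_of_pos_of_lt_pi hθ (by linarith)
  have hs1 := Real.sin_le_one θ
  by_contra! hcon
  set s := min θ ((P - A * Real.cos θ) / 2) with hsdef
  have hs0 : 0 < s := lt_min hθ (by linarith)
  have hsθ : s ≤ θ := min_le_left _ _
  have hsd : s ≤ (P - A * Real.cos θ) / 2 := min_le_right _ _
  have := h (s / θ) ⟨by positivity, (div_le_one hθ).2 hsθ⟩
  have e1 : s / θ * θ = s := by field_simp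
  have e2 : (1 - s / θ) * θ = θ - s := by field_simp
  rw [e1, e2, Real.sin_sub] at this
  have k : Real.sin s * P + (Real.sin θ * Real.cos s - Real.cos θ * Real.sin s) * A
      ≤ A * Real.sin θ := by
    rw [← div_le_iff₀ hs]
    refine le_of_eq_of_le ?_ this
    ring
  have hss : 0 < Real.sin s := Real.sin_pos_of_pos_of_lt_pi hs0 (by linarith)
  have hc : 0 ≤ Real.cos s := Real.cos_nonneg_of_neg_pi_div_two_le_of_le (by linarith) (by linarith)
  have hc1 := Real.cos_le_one s
  have hsq := Real.sin_sq_add_cos_sq s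
  have hle : Real.sin s ≤ s := Real.sin_le hs0.le
  have k2 : 1 - Real.cos s ≤ Real.sin s ^ 2 := by nlinarith
  have k3 : (A * Real.sin θ) * (1 - Real.cos s) ≤ 1 * Real.sin s ^ 2 :=
    mul_le_mul (by nlinarith) k2 (by linarith) (by norm_num)
  have k4 : Real.sin s * (P - A * Real.cos θ) ≤ Real.sin s * Real.sin s := by nlinarith
  have k5 := le_of_mul_le_mul_left k4 hss
  linarith

end helpers

/-- In the CQ setting, `n ↦ d(x₁, x_n)` is nondecreasing, bounded above by
`d(x₁, p) < π/2` for every `p ∈ F`, and consequently `cos d(x₁, x_n)`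
converges to a positive limit. -/
theorem cq_distances_monotone_and_bounded
    {H : Type*} [NormedAddCommGroup H] [InnerProductSpace ℝ H]
    -- `C` is a nonempty closed convex subset of the unit sphere `S_H`
    (C : Set H) (hCsphere : ∀ v ∈ C, ‖v‖ = 1)
    (hCne : C.Nonempty) (hCclosed : IsClosed C) (hCconv : SphConvex C)
    (hCdiam : ∀ v ∈ C, ∀ v' ∈ C, sphDist v v' < Real.pi / 2)
    (a : ℝ) (ha0 : 0 < a) (ha1 : a < 1 / 2)
    (r : ℕ) (hr : 1 ≤ r)
    (α : ℕ → ℕ → ℝ)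
    (hα : ∀ n, 1 ≤ n → ∀ i, 1 ≤ i → i ≤ r → α n i ∈ Set.Icc a (1 - a))
    -- `T_1, …, T_r` are nonexpansive self-mappings of `C`
    (T : ℕ → H → H)
    (hTmaps : ∀ i, 1 ≤ i → i ≤ r → ∀ v ∈ C, T i v ∈ C)
    (hTnonexp : ∀ i, 1 ≤ i → i ≤ r → ∀ v ∈ C, ∀ v' ∈ C,
      sphDist (T i v) (T i v') ≤ sphDist v v')
    -- `F := ⋂ᵢ F(Tᵢ) ≠ ∅`
    (F : Set H)
    (hF : F = ⋂ i ∈ Finset.Icc 1 r, {z ∈ C | T i z = z})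
    (hFne : F.Nonempty)
    -- the CQ iteration: `y_n = W_n x_n`, `x_{n+1} = P_{C_n ∩ Q_n} x_1`
    (x y : ℕ → H) (hx1 : x 1 ∈ C)
    (hy : ∀ n, y n = Uiter T (α n) r (x n))
    (CS QS : ℕ → Set H)
    (hCS : ∀ n, CS n = {z ∈ C | sphDist (y n) z ≤ sphDist (x n) z})
    (hQS : ∀ n, QS n = {z ∈ C |
      Real.cos (sphDist (x 1) z) ≤
        Real.cos (sphDist (x 1) (x n)) * Real.cos (sphDist (x n) z)})
    (hxmem : ∀ n, 1 ≤ n → x (n + 1) ∈ CS n ∩ QS n)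
    (hxproj : ∀ n, 1 ≤ n → ∀ z ∈ CS n ∩ QS n,
      sphDist (x 1) (x (n + 1)) ≤ sphDist (x 1) z)
    :
    (∀ n, 1 ≤ n → sphDist (x 1) (x n) ≤ sphDist (x 1) (x (n + 1))) ∧
      (∀ p ∈ F, ∀ n, 1 ≤ n →
        sphDist (x 1) (x n) ≤ sphDist (x 1) p ∧ sphDist (x 1) p < Real.pi / 2) ∧
      ∃ b : ℝ, 0 < b ∧
        Tendsto (fun n => Real.cos (sphDist (x 1) (x n))) atTop (𝓝 b) := by
  subst hF
  have hFmem : ∀ p ∈ ⋂ i ∈ Finset.Icc 1 r, {z ∈ C | T i z = z},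
      p ∈ C ∧ ∀ i, 1 ≤ i → i ≤ r → T i p = p := by
    intro p hp
    simp only [Set.mem_iInter, Finset.mem_Icc, Set.mem_setOf_eq] at hp
    exact ⟨(hp 1 ⟨le_rfl, hr⟩).1, fun i h1 h2 => (hp i ⟨h1, h2⟩).2⟩
  have hpos : ∀ u ∈ C, ∀ v ∈ C, 0 < inner ℝ u v := fun u hu v hv =>
    Real.arccos_lt_pi_div_two.1 (hCdiam u hu v hv)
  have hxC : ∀ n, 1 ≤ n → x n ∈ C := by
    intro n hn
    obtain rfl | h := eq_or_lt_of_le hn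
    · exact hx1
    · obtain ⟨m, rfl⟩ : ∃ m, n = m + 1 := ⟨n - 1, by omega⟩
      have := (hxmem m (by omega)).1
      rw [hCS] at this
      exact this.1
  have hα' : ∀ n, 1 ≤ n → ∀ i, 1 ≤ i → i ≤ r → α n i ∈ Set.Icc (0 : ℝ) 1 := fun n hn i h1 h2 =>
    ⟨ha0.le.trans (hα n hn i h1 h2).1, (hα n hn i h1 h2).2.trans (by linarith)⟩
  have hU : ∀ n, 1 ≤ n → ∀ i, i ≤ r → Uiter T (α n) i (x n) ∈ C := by
    intro n hn i
    induction i with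
    | zero => exact fun _ => hxC n hn
    | succ i ih =>
      intro hi
      exact hCconv _ (hTmaps (i + 1) (by omega) hi _ (ih (by omega))) _ (hxC n hn) _
        (hα' n hn (i + 1) (by omega) hi)
  have hyC : ∀ n, 1 ≤ n → y n ∈ C := fun n hn => by rw [hy]; exact hU n hn r le_rfl
  have hUp : ∀ p ∈ ⋂ i ∈ Finset.Icc 1 r, {z ∈ C | T i z = z}, ∀ n, 1 ≤ n → ∀ i, i ≤ r →
      inner ℝ p (x n) ≤ inner ℝ p (Uiter T (α n) i (x n)) := by
    intro p hp n hn i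
    obtain ⟨hpC, hpT⟩ := hFmem p hp
    induction i with
    | zero => exact fun _ => le_rfl
    | succ i ih =>
      intro hi
      have hUC := hU n hn i (by omega)
      have hTC := hTmaps (i + 1) (by omega) hi _ hUC
      refine geo_lower (hCsphere _ hTC) (hCsphere _ (hxC n hn)) (hCdiam _ hTC _ (hxC n hn))
        (hα' n hn (i + 1) (by omega) hi) (hpos _ hpC _ (hxC n hn)).le ?_ le_rfl
      refine (ih (by omega)).trans ?_
      have := hTnonexp (i + 1) (by omega) hi p hpC _ hUC
      rw [hpT (i + 1) (by omega) hi] at this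
      exact (sphDist_le_iff (hCsphere _ hpC) (hCsphere _ hTC) (hCsphere _ hpC)
        (hCsphere _ hUC)).1 this
  have hCS' : ∀ n, 1 ≤ n → ∀ z, z ∈ CS n ↔ z ∈ C ∧ 0 ≤ inner ℝ (y n - x n) z := by
    intro n hn z
    rw [hCS, Set.mem_setOf_eq]
    refine and_congr_right fun hz => ?_
    rw [sphDist_le_iff (hCsphere _ (hyC n hn)) (hCsphere _ hz) (hCsphere _ (hxC n hn))
      (hCsphere _ hz), inner_sub_left, sub_nonneg]
  have hQS' : ∀ n, 1 ≤ n → ∀ z, z ∈ QS n ↔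
      z ∈ C ∧ inner ℝ (x 1) z ≤ inner ℝ (x 1) (x n) * inner ℝ (x n) z := by
    intro n hn z
    rw [hQS, Set.mem_setOf_eq]
    refine and_congr_right fun hz => ?_
    rw [cos_sphDist (hCsphere _ hx1) (hCsphere _ hz),
      cos_sphDist (hCsphere _ hx1) (hCsphere _ (hxC n hn)),
      cos_sphDist (hCsphere _ (hxC n hn)) (hCsphere _ hz)]
  have hQS'' : ∀ n, 1 ≤ n → ∀ z, z ∈ QS n ↔
      z ∈ C ∧ 0 ≤ inner ℝ ((inner ℝ (x 1) (x n) : ℝ) • x n - x 1) z := by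
    intro n hn z
    rw [hQS' n hn, inner_sub_left, sub_nonneg, real_inner_smul_left]
  have hFC : ∀ p ∈ ⋂ i ∈ Finset.Icc 1 r, {z ∈ C | T i z = z}, ∀ n, 1 ≤ n → p ∈ CS n := by
    intro p hp n hn
    have h := hUp p hp n hn r le_rfl
    rw [← hy, real_inner_comm, real_inner_comm (y n)] at h
    rw [hCS' n hn, inner_sub_left, sub_nonneg]
    exact ⟨(hFmem p hp).1, h⟩
  have hFQ : ∀ p ∈ ⋂ i ∈ Finset.Icc 1 r, {z ∈ C | T i z = z}, ∀ n, 1 ≤ n → p ∈ QS n := by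
    intro p hp n hn
    have hpC := (hFmem p hp).1
    induction n, hn using Nat.le_induction with
    | base =>
      rw [hQS' 1 le_rfl]
      refine ⟨hpC, ?_⟩
      rw [real_inner_self_eq_norm_sq, hCsphere _ hx1]
      simp
    | succ n hn ih =>
      rw [hQS' (n + 1) (by omega)]
      refine ⟨hpC, ?_⟩
      have hqC := hxC (n + 1) (by omega)
      have hpn := hCsphere _ hpC
      have hqn := hCsphere _ hqC
      have hd := hCdiam _ hpC _ hqC
      refine proj_ineq hpn hqn (hCsphere _ hx1) hd (hpos _ hx1 _ hqC).le ?_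
      intro t ht
      have hgC := hCconv _ hpC _ hqC t ht
      have hm := hxmem n hn
      have hg : geo t p (x (n + 1)) ∈ CS n ∩ QS n :=
        ⟨(hCS' n hn _).2 ⟨hgC, geo_lower hpn hqn hd ht le_rfl ((hCS' n hn _).1 (hFC p hp n hn)).2
          ((hCS' n hn _).1 hm.1).2⟩,
        (hQS'' n hn _).2 ⟨hgC, geo_lower hpn hqn hd ht le_rfl ((hQS'' n hn _).1 ih).2
          ((hQS'' n hn _).1 hm.2).2⟩⟩
      exact (sphDist_le_iff (hCsphere _ hx1) hqn (hCsphere _ hx1) (hCsphere _ hgC)).1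
        (hxproj n hn _ hg)
  have hQle : ∀ n, 1 ≤ n → ∀ z ∈ QS n, inner ℝ (x 1) z ≤ inner ℝ (x 1) (x n) := by
    intro n hn z hz
    obtain ⟨hzC, hz⟩ := (hQS' n hn z).1 hz
    exact hz.trans (mul_le_of_le_one_right (hpos _ hx1 _ (hxC n hn)).le
      (inner_le_one' (hCsphere _ (hxC n hn)) (hCsphere _ hzC)))
  refine ⟨fun n hn => ?_, fun p hp n hn => ⟨?_, hCdiam _ hx1 _ (hFmem p hp).1⟩, ?_⟩
  · exact (sphDist_le_iff (hCsphere _ hx1) (hCsphere _ (hxC n hn)) (hCsphere _ hx1)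
      (hCsphere _ (hxC _ (by omega)))).2 (hQle n hn _ (hxmem n hn).2)
  · exact (sphDist_le_iff (hCsphere _ hx1) (hCsphere _ (hxC n hn)) (hCsphere _ hx1)
      (hCsphere _ (hFmem p hp).1)).2 (hQle n hn _ (hFQ p hp n hn))
  · obtain ⟨p, hp⟩ := hFne
    have hanti : Antitone (fun n => (inner ℝ (x 1) (x (n + 1)) : ℝ)) :=
      antitone_nat_of_succ_le fun n => hQle (n + 1) (by omega) _ (hxmem (n + 1) (by omega)).2
    have hlow : ∀ n, inner ℝ (x 1) p ≤ inner ℝ (x 1) (x (n + 1)) := fun n =>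
      hQle (n + 1) (by omega) _ (hFQ p hp (n + 1) (by omega))
    refine ⟨⨅ n, inner ℝ (x 1) (x (n + 1)),
      (hpos _ hx1 _ (hFmem p hp).1).trans_le (le_ciInf hlow), ?_⟩
    rw [← tendsto_add_atTop_iff_nat 1]
    have := tendsto_atTop_ciInf hanti ⟨_, Set.forall_mem_range.2 hlow⟩
    refine this.congr fun n => ?_
    exact (cos_sphDist (hCsphere _ hx1) (hCsphere _ (hxC _ (by omega)))).symm
end
end

section
/- In the CQ setting described in the context, writing U_{n,0} := I and U_{n,i} x := α_{n,i} (T_i (U_{n,i-1} x)) ⊕ (1-α_{n,i}) x for i = 1,…,r (so that W_n = U_{n,r}), one has d(W_n x_n, x_n) = α_{n,r} · d(T_r U_{n,r-1} x_n, x_n) ≤ 2 d(x_n, x_{n+1}) for every n; consequently lim_{n→∞} d(W_n x_n, x_n) = 0 and lim_{n→∞} d(T_r U_{n,r-1} x_n, x_n) = 0. -/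
open Filter Topology

noncomputable section

open scoped Classical

lemma inner_le_one_aux {H : Type*} [NormedAddCommGroup H] [InnerProductSpace ℝ H]
    {p q : H} (hp : ‖p‖ = 1) (hq : ‖q‖ = 1) : inner ℝ p q ≤ 1 := by
  have := real_inner_le_norm p q
  rw [hp, hq] at this; linarith

lemma neg_one_le_inner_aux {H : Type*} [NormedAddCommGroup H] [InnerProductSpace ℝ H]
    {p q : H} (hp : ‖p‖ = 1) (hq : ‖q‖ = 1) : -1 ≤ inner ℝ p q := by
  have := neg_le_of_abs_le (abs_real_inner_le_norm p q)
  rw [hp, hq] at this; linarith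

lemma cos_sphDist_s6 {H : Type*} [NormedAddCommGroup H] [InnerProductSpace ℝ H]
    {p q : H} (hp : ‖p‖ = 1) (hq : ‖q‖ = 1) : Real.cos (sphDist p q) = inner ℝ p q :=
  Real.cos_arccos (neg_one_le_inner_aux hp hq) (inner_le_one_aux hp hq)

lemma sphDist_le_iff_s6 {H : Type*} [NormedAddCommGroup H] [InnerProductSpace ℝ H]
    {p q p' q' : H} (hp : ‖p‖ = 1) (hq : ‖q‖ = 1) (hp' : ‖p'‖ = 1) (hq' : ‖q'‖ = 1) :
    sphDist p q ≤ sphDist p' q' ↔ inner ℝ p' q' ≤ inner ℝ p q := by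
  rw [← cos_sphDist_s6 hp hq, ← cos_sphDist_s6 hp' hq']
  exact (Real.strictAntiOn_cos.le_iff_ge ⟨Real.arccos_nonneg _, Real.arccos_le_pi _⟩
    ⟨Real.arccos_nonneg _, Real.arccos_le_pi _⟩).symm

lemma sphDist_eq_angle {H : Type*} [NormedAddCommGroup H] [InnerProductSpace ℝ H]
    {p q : H} (hp : ‖p‖ = 1) (hq : ‖q‖ = 1) :
    sphDist p q = InnerProductGeometry.angle p q := by
  simp [sphDist, InnerProductGeometry.angle, hp, hq]

lemma sphDist_symm {H : Type*} [NormedAddCommGroup H] [InnerProductSpace ℝ H]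
    (p q : H) : sphDist p q = sphDist q p := by
  simp only [sphDist, real_inner_comm]

lemma sphDist_triangle {H : Type*} [NormedAddCommGroup H] [InnerProductSpace ℝ H]
    {p q s : H} (hp : ‖p‖ = 1) (hq : ‖q‖ = 1) (hs : ‖s‖ = 1) :
    sphDist p s ≤ sphDist p q + sphDist q s := by
  rw [sphDist_eq_angle hp hq, sphDist_eq_angle hp hs, sphDist_eq_angle hq hs]
  exact InnerProductGeometry.angle_le_angle_add_angle p q s

lemma sphDist_pos_s6 {H : Type*} [NormedAddCommGroup H] [InnerProductSpace ℝ H]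
    {p q : H} (hp : ‖p‖ = 1) (hq : ‖q‖ = 1) (h : p ≠ q) : 0 < sphDist p q := by
  refine Real.arccos_pos.2 (lt_of_le_of_ne (inner_le_one_aux hp hq) fun h1 => h ?_)
  exact (inner_eq_one_iff_of_norm_eq_one (𝕜 := ℝ) hp hq).1 h1

lemma inner_geo {H : Type*} [NormedAddCommGroup H] [InnerProductSpace ℝ H]
    (t : ℝ) {p q : H} (h : p ≠ q) (z : H) :
    inner ℝ (geo t p q) z = (Real.sin (t * sphDist p q) / Real.sin (sphDist p q)) * inner ℝ p z
     + (Real.sin ((1 - t) * sphDist p q) / Real.sin (sphDist p q)) * inner ℝ q z := by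
  simp [geo, h, inner_add_left, real_inner_smul_left]

lemma sin_coef {t θ : ℝ} (ht0 : 0 ≤ t) (ht1 : t ≤ 1) (h0 : 0 < θ) (h1 : θ < Real.pi) :
    0 < Real.sin θ ∧ 0 ≤ Real.sin (t * θ) / Real.sin θ ∧
    0 ≤ Real.sin ((1 - t) * θ) / Real.sin θ ∧
    1 ≤ Real.sin (t * θ) / Real.sin θ + Real.sin ((1 - t) * θ) / Real.sin θ := by
  have hs := Real.sin_pos_of_pos_of_lt_pi h0 h1
  have h2 : 0 ≤ Real.sin (t * θ) :=
    Real.sin_nonneg_of_nonneg_of_le_pi (by positivity) (by nlinarith)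
  have h3 : 0 ≤ Real.sin ((1 - t) * θ) :=
    Real.sin_nonneg_of_nonneg_of_le_pi (mul_nonneg (by linarith) h0.le) (by nlinarith)
  refine ⟨hs, by positivity, by positivity, ?_⟩
  rw [← add_div, le_div_iff₀ hs, one_mul]
  have : Real.sin θ = Real.sin (t * θ + (1 - t) * θ) := by congr 1; ring
  rw [this, Real.sin_add]
  nlinarith [Real.cos_le_one (t * θ), Real.cos_le_one ((1 - t) * θ)]

lemma sphDist_geo {H : Type*} [NormedAddCommGroup H] [InnerProductSpace ℝ H]
    {t : ℝ} (ht0 : 0 ≤ t) (ht1 : t ≤ 1) {p q : H} (hp : ‖p‖ = 1) (hq : ‖q‖ = 1)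
    (hd : sphDist p q < Real.pi) : sphDist (geo t p q) q = t * sphDist p q := by
  by_cases h : p = q
  · subst h
    simp [geo, sphDist, hp]
  · have h0 := sphDist_pos_s6 hp hq h
    obtain ⟨hs, -⟩ := sin_coef ht0 ht1 h0 hd
    have : inner ℝ (geo t p q) q = Real.cos (t * sphDist p q) := by
      rw [inner_geo t h, ← cos_sphDist_s6 hp hq, real_inner_self_eq_norm_sq, hq, sub_mul, one_mul,
        Real.sin_sub]
      field_simp
      ring
    rw [sphDist, this, Real.arccos_cos (by positivity) (by nlinarith)]

/-- projection inequality -/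
lemma proj_ineq_s6 {H : Type*} [NormedAddCommGroup H] [InnerProductSpace ℝ H]
    {u p z : H} (hp : ‖p‖ = 1) (hz : ‖z‖ = 1) (hd : sphDist z p < Real.pi)
    (hmin : ∀ t ∈ Set.Icc (0 : ℝ) 1, inner ℝ (geo t z p) u ≤ inner ℝ p u) :
    inner ℝ z u ≤ inner ℝ p u * inner ℝ z p := by
  by_cases h : z = p
  · subst h
    simp [hz]
  have h0 := sphDist_pos_s6 hz hp h
  rw [← cos_sphDist_s6 hz hp]
  set θ := sphDist z p with hθ
  set A := inner ℝ z u
  set B := inner ℝ p u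
  have key : ∀ᶠ s in 𝓝[>] (0 : ℝ), (A - B * Real.cos θ) * Real.cos (s / 2) ≤
      B * Real.sin θ * Real.sin (s / 2) := by
    filter_upwards [Ioo_mem_nhdsGT h0] with s hs
    have hs0 := hs.1
    have hs1 := hs.2
    have hsin : 0 < Real.sin θ := Real.sin_pos_of_pos_of_lt_pi h0 hd
    have h2 : 0 < Real.sin (s / 2) :=
      Real.sin_pos_of_pos_of_lt_pi (by linarith) (by linarith)
    have := hmin (s / θ) ⟨by positivity, by rw [div_le_one h0]; exact hs1.le⟩
    rw [inner_geo _ h, ← hθ, sub_mul, div_mul_cancel₀ _ h0.ne', one_mul, Real.sin_sub] at this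
    have e1 : Real.sin s = 2 * Real.sin (s / 2) * Real.cos (s / 2) := by
      rw [← Real.sin_two_mul]; congr 1; ring
    have e2 : Real.cos s = 1 - 2 * Real.sin (s / 2) ^ 2 := by
      have := Real.cos_sq_add_sin_sq (s / 2)
      have h3 : Real.cos s = Real.cos (2 * (s / 2)) := by congr 1; ring
      rw [h3, Real.cos_two_mul]; linarith
    have h4 : Real.sin s * A + (Real.sin θ * Real.cos s - Real.cos θ * Real.sin s) * B
        ≤ B * Real.sin θ := by
      rw [← div_le_iff₀ hsin]
      refine le_trans (le_of_eq ?_) this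
      field_simp
      rfl
    rw [e1, e2] at h4
    have h5 : Real.sin (s / 2) * ((A - B * Real.cos θ) * Real.cos (s / 2)) ≤
      Real.sin (s / 2) * (B * Real.sin θ * Real.sin (s / 2)) := by nlinarith
    exact le_of_mul_le_mul_left h5 h2
  have c1 : Tendsto (fun s : ℝ => (A - B * Real.cos θ) * Real.cos (s / 2)) (𝓝[>] 0)
      (𝓝 ((A - B * Real.cos θ) * Real.cos (0 / 2))) :=
    (Continuous.tendsto (by fun_prop) 0).mono_left nhdsWithin_le_nhds
  have c2 : Tendsto (fun s : ℝ => B * Real.sin θ * Real.sin (s / 2)) (𝓝[>] 0)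
      (𝓝 (B * Real.sin θ * Real.sin (0 / 2))) :=
    (Continuous.tendsto (by fun_prop) 0).mono_left nhdsWithin_le_nhds
  have := le_of_tendsto_of_tendsto c1 c2 key
  simp at this
  exact this

/-- In the CQ setting, with `U_{n,0} = I` and
`U_{n,i} x = α_{n,i} (T_i (U_{n,i-1} x)) ⊕ (1-α_{n,i}) x` (so `W_n = U_{n,r}`),
one has `d(W_n x_n, x_n) = α_{n,r} · d(T_r U_{n,r-1} x_n, x_n) ≤ 2 d(x_n, x_{n+1})`
for every `n`; consequently `d(W_n x_n, x_n) → 0` and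
`d(T_r U_{n,r-1} x_n, x_n) → 0`. -/
theorem cq_W_displacement
    {H : Type*} [NormedAddCommGroup H] [InnerProductSpace ℝ H]
    -- `C` is a nonempty closed convex subset of the unit sphere `S_H`
    (C : Set H) (hCsphere : ∀ v ∈ C, ‖v‖ = 1)
    (hCne : C.Nonempty) (hCclosed : IsClosed C) (hCconv : SphConvex C)
    (hCdiam : ∀ v ∈ C, ∀ v' ∈ C, sphDist v v' < Real.pi / 2)
    (a : ℝ) (ha0 : 0 < a) (ha1 : a < 1 / 2)
    (r : ℕ) (hr : 1 ≤ r)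
    (α : ℕ → ℕ → ℝ)
    (hα : ∀ n, 1 ≤ n → ∀ i, 1 ≤ i → i ≤ r → α n i ∈ Set.Icc a (1 - a))
    -- `T_1, …, T_r` are nonexpansive self-mappings of `C`
    (T : ℕ → H → H)
    (hTmaps : ∀ i, 1 ≤ i → i ≤ r → ∀ v ∈ C, T i v ∈ C)
    (hTnonexp : ∀ i, 1 ≤ i → i ≤ r → ∀ v ∈ C, ∀ v' ∈ C,
      sphDist (T i v) (T i v') ≤ sphDist v v')
    -- `F := ⋂ᵢ F(Tᵢ) ≠ ∅`
    (F : Set H)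
    (hF : F = ⋂ i ∈ Finset.Icc 1 r, {z ∈ C | T i z = z})
    (hFne : F.Nonempty)
    -- the CQ iteration: `y_n = W_n x_n`, `x_{n+1} = P_{C_n ∩ Q_n} x_1`
    (x y : ℕ → H) (hx1 : x 1 ∈ C)
    (hy : ∀ n, y n = Uiter T (α n) r (x n))
    (CS QS : ℕ → Set H)
    (hCS : ∀ n, CS n = {z ∈ C | sphDist (y n) z ≤ sphDist (x n) z})
    (hQS : ∀ n, QS n = {z ∈ C |
      Real.cos (sphDist (x 1) z) ≤
        Real.cos (sphDist (x 1) (x n)) * Real.cos (sphDist (x n) z)})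
    (hxmem : ∀ n, 1 ≤ n → x (n + 1) ∈ CS n ∩ QS n)
    (hxproj : ∀ n, 1 ≤ n → ∀ z ∈ CS n ∩ QS n,
      sphDist (x 1) (x (n + 1)) ≤ sphDist (x 1) z)
    :
    (∀ n, 1 ≤ n →
      sphDist (Uiter T (α n) r (x n)) (x n) =
        α n r * sphDist (T r (Uiter T (α n) (r - 1) (x n))) (x n) ∧
      sphDist (Uiter T (α n) r (x n)) (x n) ≤ 2 * sphDist (x n) (x (n + 1))) ∧
      Tendsto (fun n => sphDist (Uiter T (α n) r (x n)) (x n)) atTop (𝓝 0) ∧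
      Tendsto (fun n => sphDist (T r (Uiter T (α n) (r - 1) (x n))) (x n))
        atTop (𝓝 0) := by
  have hpi := Real.pi_pos
  have hpos : ∀ v ∈ C, ∀ v' ∈ C, 0 < inner ℝ v v' := fun v hv v' hv' =>
    Real.arccos_lt_pi_div_two.1 (hCdiam v hv v' hv')
  have hdpi : ∀ v ∈ C, ∀ v' ∈ C, sphDist v v' < Real.pi := fun v hv v' hv' => by
    linarith [hCdiam v hv v' hv']
  have hxC : ∀ n, 1 ≤ n → x n ∈ C := by
    intro n hn
    rcases Nat.exists_eq_succ_of_ne_zero (by omega : n ≠ 0) with ⟨m, rfl⟩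
    rcases Nat.eq_zero_or_pos m with rfl | hm
    · exact hx1
    · have := (hxmem m hm).1
      rw [hCS] at this
      exact this.1
  have hα01 : ∀ n, 1 ≤ n → ∀ i, 1 ≤ i → i ≤ r → α n i ∈ Set.Icc (0 : ℝ) 1 := by
    intro n hn i h1 h2
    have := hα n hn i h1 h2
    exact ⟨by linarith [this.1], by linarith [this.2]⟩
  have hUC : ∀ n, 1 ≤ n → ∀ v ∈ C, ∀ i, i ≤ r → Uiter T (α n) i v ∈ C := by
    intro n hn v hv i
    induction i with
    | zero => intro _; exact hv
    | succ i ih =>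
      intro hi
      exact hCconv _ (hTmaps _ (by omega) hi _ (ih (by omega))) _ hv _
        (hα01 n hn _ (by omega) hi)
  -- geodesic combinations stay in half-spaces
  have hgeo : ∀ p ∈ C, ∀ q ∈ C, ∀ t ∈ Set.Icc (0 : ℝ) 1, ∀ w : H, 0 ≤ inner ℝ p w →
      0 ≤ inner ℝ q w → 0 ≤ inner ℝ (geo t p q) w := by
    intro p hp q hq t ht w h1 h2
    by_cases h : p = q
    · subst h; simpa [geo] using h1
    obtain ⟨-, h3, h4, -⟩ := sin_coef ht.1 ht.2
      (sphDist_pos_s6 (hCsphere p hp) (hCsphere q hq) h) (hdpi p hp q hq)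
    rw [inner_geo t h]
    positivity
  have hgeo2 : ∀ p ∈ C, ∀ q ∈ C, ∀ t ∈ Set.Icc (0 : ℝ) 1, ∀ (w : H) (c : ℝ), 0 ≤ c →
      c ≤ inner ℝ p w → c ≤ inner ℝ q w → c ≤ inner ℝ (geo t p q) w := by
    intro p hp q hq t ht w c hc h1 h2
    by_cases h : p = q
    · subst h; simpa [geo] using h1
    obtain ⟨-, h3, h4, h5⟩ := sin_coef ht.1 ht.2
      (sphDist_pos_s6 (hCsphere p hp) (hCsphere q hq) h) (hdpi p hp q hq)
    rw [inner_geo t h]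
    nlinarith [mul_le_mul_of_nonneg_left h1 h3, mul_le_mul_of_nonneg_left h2 h4,
      mul_le_mul_of_nonneg_right h5 hc]
  obtain ⟨z, hz⟩ := hFne
  have hzF : ∀ i, 1 ≤ i → i ≤ r → z ∈ C ∧ T i z = z := by
    intro i h1 h2
    rw [hF] at hz
    simp only [Set.mem_iInter] at hz
    exact hz i (Finset.mem_Icc.2 ⟨h1, h2⟩)
  have hzC : z ∈ C := (hzF 1 le_rfl hr).1
  have hz1 := hCsphere z hzC
  have hUz : ∀ n, 1 ≤ n → ∀ v ∈ C, ∀ i, i ≤ r →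
      inner ℝ v z ≤ inner ℝ (Uiter T (α n) i v) z := by
    intro n hn v hv i
    induction i with
    | zero => intro _; exact le_rfl
    | succ i ih =>
      intro hi
      have hU := hUC n hn v hv i (by omega)
      have hT := hTmaps (i + 1) (by omega) hi _ hU
      refine hgeo2 _ hT _ hv _ (hα01 n hn _ (by omega) hi) z _ (hpos v hv z hzC).le ?_ le_rfl
      have := hTnonexp (i + 1) (by omega) hi _ hU z hzC
      rw [(hzF (i + 1) (by omega) hi).2,
        sphDist_le_iff_s6 (hCsphere _ hT) hz1 (hCsphere _ hU) hz1] at this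
      exact (ih (by omega)).trans this
  have hyC : ∀ n, 1 ≤ n → y n ∈ C := fun n hn => by
    rw [hy]; exact hUC n hn _ (hxC n hn) r le_rfl
  have hCSiff : ∀ n, 1 ≤ n → ∀ w, w ∈ CS n ↔ w ∈ C ∧ 0 ≤ inner ℝ w (y n - x n) := by
    intro n hn w
    rw [hCS]
    refine and_congr_right fun hw => ?_
    rw [sphDist_le_iff_s6 (hCsphere _ (hyC n hn)) (hCsphere _ hw) (hCsphere _ (hxC n hn))
      (hCsphere _ hw), inner_sub_right, sub_nonneg, real_inner_comm, real_inner_comm w]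
  have hQSiff : ∀ n, 1 ≤ n → ∀ w, w ∈ QS n ↔ w ∈ C ∧
      0 ≤ inner ℝ w ((inner ℝ (x 1) (x n) : ℝ) • x n - x 1) := by
    intro n hn w
    rw [hQS]
    refine and_congr_right fun hw => ?_
    rw [cos_sphDist_s6 (hCsphere _ hx1) (hCsphere _ hw),
      cos_sphDist_s6 (hCsphere _ hx1) (hCsphere _ (hxC n hn)),
      cos_sphDist_s6 (hCsphere _ (hxC n hn)) (hCsphere _ hw),
      inner_sub_right, sub_nonneg, real_inner_smul_right, real_inner_comm w (x n),
      real_inner_comm w (x 1)]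
  have hzCS : ∀ n, 1 ≤ n → z ∈ CS n := by
    intro n hn
    rw [hCSiff n hn]
    refine ⟨hzC, ?_⟩
    rw [inner_sub_right, sub_nonneg, real_inner_comm, real_inner_comm (y n), hy]
    exact hUz n hn _ (hxC n hn) r le_rfl
  have hzQS : ∀ n, 1 ≤ n → z ∈ QS n := by
    intro n hn
    induction n, hn using Nat.le_induction with
    | base =>
      rw [hQSiff 1 le_rfl]
      refine ⟨hzC, ?_⟩
      rw [real_inner_self_eq_norm_sq, hCsphere _ hx1]
      simp
    | succ n hn ih =>
      have hm := hxmem n hn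
      have hp := hxC (n + 1) (by omega)
      have hpr := hxproj n hn
      rw [hQSiff (n + 1) (by omega)]
      refine ⟨hzC, ?_⟩
      have := proj_ineq_s6 (u := x 1) (hCsphere _ hp) hz1 (hdpi _ hzC _ hp) (by
        intro t ht
        have hg : geo t z (x (n + 1)) ∈ C := hCconv _ hzC _ hp t ht
        have := hpr (geo t z (x (n + 1))) ⟨by
          rw [hCSiff n hn]
          exact ⟨hg, hgeo _ hzC _ hp t ht _ ((hCSiff n hn _).1 (hzCS n hn)).2
            ((hCSiff n hn _).1 hm.1).2⟩, by
          rw [hQSiff n hn]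
          exact ⟨hg, hgeo _ hzC _ hp t ht _ ((hQSiff n hn _).1 ih).2
            ((hQSiff n hn _).1 hm.2).2⟩⟩
        rw [sphDist_le_iff_s6 (hCsphere _ hx1) (hCsphere _ hp) (hCsphere _ hx1)
          (hCsphere _ hg)] at this
        rw [real_inner_comm, real_inner_comm (x 1) (x (n + 1))]
        exact this)
      rw [inner_sub_right, sub_nonneg, real_inner_smul_right,
        real_inner_comm (x (n + 1)) (x 1)]
      exact this
  have hlow : ∀ n, 1 ≤ n → inner ℝ (x 1) z ≤ inner ℝ (x 1) (x (n + 1)) := by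
    intro n hn
    have := hxproj n hn z ⟨hzCS n hn, hzQS n hn⟩
    rwa [sphDist_le_iff_s6 (hCsphere _ hx1) (hCsphere _ (hxC (n + 1) (by omega)))
      (hCsphere _ hx1) hz1] at this
  have hstep : ∀ n, 1 ≤ n → inner ℝ (x 1) (x (n + 1)) ≤
      inner ℝ (x 1) (x n) * (inner ℝ (x n) (x (n + 1)) : ℝ) := by
    intro n hn
    have := ((hQSiff n hn _).1 (hxmem n hn).2).2
    rw [inner_sub_right, sub_nonneg, real_inner_smul_right, real_inner_comm (x 1) (x (n + 1)),
      real_inner_comm (x n) (x (n + 1))] at this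
    exact this
  have hle1 : ∀ n, 1 ≤ n → (inner ℝ (x n) (x (n + 1)) : ℝ) ≤ 1 := fun n hn =>
    inner_le_one_aux (hCsphere _ (hxC n hn)) (hCsphere _ (hxC (n + 1) (by omega)))
  let c : ℕ → ℝ := fun n => inner ℝ (x 1) (x (n + 2))
  have hcanti : Antitone c := by
    refine antitone_nat_of_succ_le fun n => ?_
    have h1 := hstep (n + 2) (by omega)
    have h2 := hle1 (n + 2) (by omega)
    have h3 := hpos _ hx1 _ (hxC (n + 2) (by omega))
    exact h1.trans (mul_le_of_le_one_right h3.le h2)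
  have hL := tendsto_atTop_ciInf hcanti
    ⟨inner ℝ (x 1) z, by rintro _ ⟨n, rfl⟩; exact hlow (n + 1) (by omega)⟩
  set L := ⨅ n, c n
  have hLpos : 0 < L := lt_of_lt_of_le (hpos _ hx1 _ hzC)
    (ge_of_tendsto' hL fun n => hlow (n + 1) (by omega))
  have hratio : Tendsto (fun n => c (n + 1) / c n) atTop (𝓝 1) := by
    have := (hL.comp (tendsto_add_atTop_nat 1)).div hL hLpos.ne'
    rwa [div_self hLpos.ne'] at this
  have hin : Tendsto (fun n => (inner ℝ (x (n + 2)) (x (n + 2 + 1)) : ℝ)) atTop (𝓝 1) := by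
    refine tendsto_of_tendsto_of_tendsto_of_le_of_le hratio tendsto_const_nhds ?_
      fun n => hle1 (n + 2) (by omega)
    intro n
    have h3 := hpos _ hx1 _ (hxC (n + 2) (by omega))
    show c (n + 1) / c n ≤ _
    rw [div_le_iff₀ h3, mul_comm]
    exact hstep (n + 2) (by omega)
  have hdist : Tendsto (fun n => sphDist (x n) (x (n + 1))) atTop (𝓝 0) := by
    refine (tendsto_add_atTop_iff_nat 2).1 ?_
    have := (Real.continuous_arccos.tendsto 1).comp hin
    rwa [Real.arccos_one] at this
  have hmain : ∀ n, 1 ≤ n →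
      sphDist (Uiter T (α n) r (x n)) (x n) =
        α n r * sphDist (T r (Uiter T (α n) (r - 1) (x n))) (x n) ∧
      sphDist (Uiter T (α n) r (x n)) (x n) ≤ 2 * sphDist (x n) (x (n + 1)) := by
    intro n hn
    have hxn := hxC n hn
    have hxn1 := hxC (n + 1) (by omega)
    constructor
    · obtain ⟨s, rfl⟩ : ∃ s, r = s + 1 := ⟨r - 1, by omega⟩
      have hTm := hTmaps (s + 1) hr le_rfl _ (hUC n hn _ hxn s (by omega))
      have h01 := hα01 n hn (s + 1) hr le_rfl
      exact sphDist_geo h01.1 h01.2 (hCsphere _ hTm) (hCsphere _ hxn) (hdpi _ hTm _ hxn)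
    · have h1 := (hxmem n hn).1
      rw [hCS] at h1
      have h2 := sphDist_triangle (hCsphere _ (hyC n hn)) (hCsphere _ hxn1) (hCsphere _ hxn)
      have h3 := h1.2
      rw [sphDist_symm (x (n + 1)) (x n)] at h2
      rw [← hy]
      linarith
  have hW : Tendsto (fun n => sphDist (Uiter T (α n) r (x n)) (x n)) atTop (𝓝 0) := by
    refine tendsto_of_tendsto_of_tendsto_of_le_of_le' tendsto_const_nhds
      (by simpa using hdist.const_mul 2) (Eventually.of_forall fun n => Real.arccos_nonneg _) ?_
    filter_upwards [eventually_ge_atTop 1] with n hn using (hmain n hn).2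
  refine ⟨hmain, hW, ?_⟩
  refine tendsto_of_tendsto_of_tendsto_of_le_of_le' tendsto_const_nhds
    (by simpa using hW.div_const a) (Eventually.of_forall fun n => Real.arccos_nonneg _) ?_
  filter_upwards [eventually_ge_atTop 1] with n hn
  rw [le_div_iff₀ ha0, (hmain n hn).1, mul_comm]
  exact mul_le_mul_of_nonneg_right (hα n hn r hr le_rfl).1 (Real.arccos_nonneg _)
end
end

section
/- In the CQ setting described in the context, lim_{n→∞} d(T_i x_n, x_n) = 0 for every i = 1,2,…,r. -/
open Filter Topology

noncomputable section

open scoped Classical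

lemma coeff_bound (a t θ : ℝ) (ha0 : 0 ≤ a) (ha1 : a ≤ 1 / 2) (h1 : a ≤ t) (h2 : t ≤ 1 - a)
    (hθ : 0 < θ) (hθ2 : θ < Real.pi / 2) :
    0 ≤ Real.sin (t * θ) / Real.sin θ ∧ 0 ≤ Real.sin ((1 - t) * θ) / Real.sin θ ∧
    1 + 2 * (a * (1 - a)) / Real.pi ^ 2 * θ ^ 2 ≤
      Real.sin (t * θ) / Real.sin θ + Real.sin ((1 - t) * θ) / Real.sin θ := by
  have hpi := Real.pi_pos
  have hsin : 0 < Real.sin θ := Real.sin_pos_of_pos_of_lt_pi hθ (by linarith)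
  have ht0 : 0 ≤ t := by linarith
  have ht1 : 0 ≤ 1 - t := by linarith
  have e1 : 0 ≤ Real.sin (t * θ) :=
    Real.sin_nonneg_of_nonneg_of_le_pi (by positivity) (by nlinarith)
  have e2 : 0 ≤ Real.sin ((1 - t) * θ) :=
    Real.sin_nonneg_of_nonneg_of_le_pi (by positivity) (by nlinarith)
  refine ⟨by positivity, by positivity, ?_⟩
  have hc : 0 < Real.cos (θ / 2) := Real.cos_pos_of_mem_Ioo ⟨by linarith, by linarith⟩
  have hs : 0 < Real.sin (θ / 2) := Real.sin_pos_of_pos_of_lt_pi (by linarith) (by linarith)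
  have hsum : Real.sin (t * θ) + Real.sin ((1 - t) * θ)
      = 2 * Real.sin (θ / 2) * Real.cos ((t - 1 / 2) * θ) := by
    have e1 : t * θ = θ / 2 + (t - 1 / 2) * θ := by ring
    have e2 : (1 - t) * θ = θ / 2 - (t - 1 / 2) * θ := by ring
    rw [e2, Real.sin_sub]
    nth_rewrite 1 [e1]
    rw [Real.sin_add]; ring
  have hd : Real.sin θ = 2 * Real.sin (θ / 2) * Real.cos (θ / 2) := by
    rw [← Real.sin_two_mul]; ring_nf
  have hq : Real.sin (t * θ) / Real.sin θ + Real.sin ((1 - t) * θ) / Real.sin θ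
      = Real.cos ((t - 1 / 2) * θ) / Real.cos (θ / 2) := by
    rw [← add_div, hsum, hd]; field_simp
  rw [hq, le_div_iff₀ hc]
  have hcm : Real.cos ((1 / 2 - a) * θ) ≤ Real.cos ((t - 1 / 2) * θ) := by
    rw [← Real.cos_abs ((t - 1 / 2) * θ)]
    apply Real.cos_le_cos_of_nonneg_of_le_pi (abs_nonneg _) (by nlinarith)
    rw [abs_mul, abs_of_pos hθ]
    apply mul_le_mul_of_nonneg_right _ hθ.le
    rw [abs_le]; constructor <;> linarith
  have hdiff : Real.cos ((1 / 2 - a) * θ) - Real.cos (θ / 2)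
      = 2 * Real.sin ((1 - a) * θ / 2) * Real.sin (a * θ / 2) := by
    have e1 : (1 / 2 - a) * θ = (1 - a) * θ / 2 - a * θ / 2 := by ring
    have e2 : θ / 2 = (1 - a) * θ / 2 + a * θ / 2 := by ring
    rw [e1, Real.cos_sub]
    have e3 : Real.cos (θ / 2) = Real.cos ((1 - a) * θ / 2 + a * θ / 2) := by rw [← e2]
    rw [e3, Real.cos_add]; ring
  have haθ : 0 ≤ a * θ := by positivity
  have haθ' : 0 ≤ (1 - a) * θ := mul_nonneg (by linarith) hθ.le
  have j1 := Real.mul_le_sin (x := (1 - a) * θ / 2) (by linarith) (by nlinarith)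
  have j2 := Real.mul_le_sin (x := a * θ / 2) (by linarith) (by nlinarith)
  have j3 : (2 / Real.pi * ((1 - a) * θ / 2)) * (2 / Real.pi * (a * θ / 2)) ≤
      Real.sin ((1 - a) * θ / 2) * Real.sin (a * θ / 2) := by
    apply mul_le_mul j1 j2 (by positivity)
    exact le_trans (by positivity) j1
  have j4 : (2 / Real.pi * ((1 - a) * θ / 2)) * (2 / Real.pi * (a * θ / 2))
      = (2 * (a * (1 - a)) / Real.pi ^ 2 * θ ^ 2) / 2 := by field_simp
  have hk : 0 ≤ 2 * (a * (1 - a)) / Real.pi ^ 2 * θ ^ 2 := by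
    have : 0 ≤ 1 - a := by linarith
    positivity
  have hc1 := Real.cos_le_one (θ / 2)
  nlinarith

lemma le_of_sq_le_sq_aux {s t : ℝ} (ht : 0 ≤ t) (h : s ^ 2 ≤ t ^ 2) : s ≤ t :=
  le_trans (le_abs_self s) (abs_le_of_sq_le_sq h ht)

section aux
variable {H : Type*} [NormedAddCommGroup H] [InnerProductSpace ℝ H]

lemma unit_norm_sub_sq (u v : H) (hu : ‖u‖ = 1) (hv : ‖v‖ = 1) :
    ‖u - v‖ ^ 2 = 2 * (1 - inner ℝ u v) := by
  rw [norm_sub_sq_real, hu, hv]; ring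

lemma inner_mem (u v : H) (hu : ‖u‖ = 1) (hv : ‖v‖ = 1) :
    -1 ≤ inner ℝ u v ∧ inner ℝ u v ≤ 1 := by
  have := abs_real_inner_le_norm u v
  rw [hu, hv, mul_one] at this
  exact abs_le.mp this

lemma cos_sphDist_s8 (u v : H) (hu : ‖u‖ = 1) (hv : ‖v‖ = 1) :
    Real.cos (sphDist u v) = inner ℝ u v :=
  Real.cos_arccos (inner_mem u v hu hv).1 (inner_mem u v hu hv).2

lemma sphDist_le_iff_s8 (u v u' v' : H) (hu : ‖u‖ = 1) (hv : ‖v‖ = 1)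
    (hu' : ‖u'‖ = 1) (hv' : ‖v'‖ = 1) :
    sphDist u v ≤ sphDist u' v' ↔ inner ℝ u' v' ≤ inner ℝ u v := by
  have h1 := inner_mem u v hu hv
  have h2 := inner_mem u' v' hu' hv'
  exact Real.strictAntiOn_arccos.le_iff_ge ⟨h1.1, h1.2⟩ ⟨h2.1, h2.2⟩

lemma geo_coeff (a t : ℝ) (u v : H) (hu : ‖u‖ = 1) (hv : ‖v‖ = 1) (hpos : 0 < inner ℝ u v)
    (ha0 : 0 ≤ a) (ha1 : a ≤ 1 / 2) (h1 : a ≤ t) (h2 : t ≤ 1 - a) :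
    ∃ s s' : ℝ, 0 ≤ s ∧ 0 ≤ s' ∧ geo t u v = s • u + s' • v ∧
      1 + 2 * (a * (1 - a)) / Real.pi ^ 2 * ‖u - v‖ ^ 2 ≤ s + s' := by
  by_cases huv : u = v
  · subst huv
    exact ⟨1, 0, by norm_num, by norm_num, by simp [geo], by simp⟩
  · have hlt : inner ℝ u v < 1 := by
      have h := unit_norm_sub_sq u v hu hv
      have : 0 < ‖u - v‖ := norm_pos_iff.mpr (sub_ne_zero.mpr huv)
      nlinarith
    have hθ : 0 < sphDist u v := Real.arccos_pos.mpr hlt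
    have hθ2 : sphDist u v < Real.pi / 2 := Real.arccos_lt_pi_div_two.mpr hpos
    obtain ⟨c1, c2, c3⟩ := coeff_bound a t (sphDist u v) ha0 ha1 h1 h2 hθ hθ2
    refine ⟨_, _, c1, c2, by simp [geo, huv], le_trans ?_ c3⟩
    have hk : 0 ≤ 2 * (a * (1 - a)) / Real.pi ^ 2 := by
      have : 0 ≤ 1 - a := by linarith
      positivity
    have : ‖u - v‖ ^ 2 ≤ sphDist u v ^ 2 := by
      rw [unit_norm_sub_sq u v hu hv, ← cos_sphDist_s8 u v hu hv]
      have := Real.one_sub_sq_div_two_le_cos (x := sphDist u v)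
      linarith
    have := mul_le_mul_of_nonneg_left this hk
    linarith

lemma geo_inner (a t : ℝ) (u v p : H) (hu : ‖u‖ = 1) (hv : ‖v‖ = 1) (hpos : 0 < inner ℝ u v)
    (ha0 : 0 ≤ a) (ha1 : a ≤ 1 / 2) (h1 : a ≤ t) (h2 : t ≤ 1 - a) (m : ℝ) (hm : 0 ≤ m)
    (hup : m ≤ inner ℝ u p) (hvp : m ≤ inner ℝ v p) :
    (1 + 2 * (a * (1 - a)) / Real.pi ^ 2 * ‖u - v‖ ^ 2) * m ≤ inner ℝ (geo t u v) p := by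
  obtain ⟨s, s', hs, hs', he, hb⟩ := geo_coeff a t u v hu hv hpos ha0 ha1 h1 h2
  rw [he, inner_add_left, real_inner_smul_left, real_inner_smul_left]
  have := mul_le_mul_of_nonneg_right hb hm
  have := mul_le_mul_of_nonneg_left hup hs
  have := mul_le_mul_of_nonneg_left hvp hs'
  linarith

/-- variational inequality for the projection -/
lemma proj_var (x q p : H) (hq : ‖q‖ = 1) (hp : ‖p‖ = 1) (hpq : 0 < inner ℝ p q)
    (hmax : ∀ t ∈ Set.Icc (0 : ℝ) 1, inner ℝ x (geo t p q) ≤ inner ℝ x q) :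
    inner ℝ x p ≤ inner ℝ x q * inner ℝ q p := by
  by_cases h : p = q
  · subst h
    rw [real_inner_self_eq_norm_sq, hp]; simp
  have hlt : inner ℝ p q < 1 := by
    have h' := unit_norm_sub_sq p q hp hq
    have : 0 < ‖p - q‖ := norm_pos_iff.mpr (sub_ne_zero.mpr h)
    nlinarith
  set θ := sphDist p q with hθd
  have hθ : 0 < θ := Real.arccos_pos.mpr hlt
  have hθ2 : θ < Real.pi / 2 := Real.arccos_lt_pi_div_two.mpr hpq
  have hsin : 0 < Real.sin θ := Real.sin_pos_of_pos_of_lt_pi hθ (by linarith)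
  have hcos : Real.cos θ = inner ℝ q p := by
    rw [hθd, cos_sphDist_s8 p q hp hq, real_inner_comm]
  set A := inner ℝ x p
  set B := inner ℝ x q
  let f : ℝ → ℝ := fun t => Real.sin (t * θ) * A + Real.sin ((1 - t) * θ) * B
  have hder : HasDerivAt f (Real.cos (0 * θ) * (1 * θ) * A
      + Real.cos ((1 - 0) * θ) * ((0 - 1) * θ) * B) 0 := by
    have d1 : HasDerivAt (fun t : ℝ => t * θ) (1 * θ) 0 := (hasDerivAt_id (0:ℝ)).mul_const θ
    have d2 : HasDerivAt (fun t : ℝ => (1 - t) * θ) ((0 - 1) * θ) 0 :=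
      ((hasDerivAt_const (0:ℝ) (1:ℝ)).sub (hasDerivAt_id (0:ℝ))).mul_const θ
    exact (d1.sin.mul_const A).add (d2.sin.mul_const B)
  have hle : ∀ t ∈ Set.Icc (0 : ℝ) 1, f t ≤ f 0 := by
    intro t ht
    have := hmax t ht
    simp only [geo, h, if_false, inner_add_right, real_inner_smul_right] at this
    rw [← hθd] at this
    have h2 : Real.sin (t * θ) / Real.sin θ * A + Real.sin ((1 - t) * θ) / Real.sin θ * B ≤ B :=
      this
    have h3 : (Real.sin (t * θ) / Real.sin θ * A + Real.sin ((1 - t) * θ) / Real.sin θ * B)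
      * Real.sin θ = f t := by
      simp only [f]; field_simp
    have h4 : f 0 = B * Real.sin θ := by simp [f, mul_comm]
    rw [h4, ← h3]
    exact mul_le_mul_of_nonneg_right h2 hsin.le
  have hd0 : Real.cos (0 * θ) * (1 * θ) * A
      + Real.cos ((1 - 0) * θ) * ((0 - 1) * θ) * B ≤ 0 := by
    have ht := (hasDerivAt_iff_tendsto_slope_zero.mp hder).mono_left
      (nhdsWithin_mono 0 (show Set.Ioi (0:ℝ) ⊆ {0}ᶜ from fun t ht => ne_of_gt ht))
    apply le_of_tendsto ht
    filter_upwards [Ioo_mem_nhdsGT (show (0:ℝ) < 1 by norm_num)] with t ht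
    have := hle t ⟨ht.1.le, ht.2.le⟩
    rw [zero_add, smul_eq_mul]
    exact mul_nonpos_of_nonneg_of_nonpos (inv_nonneg.mpr ht.1.le) (by linarith)
  simp only [zero_mul, Real.cos_zero, sub_zero, one_mul] at hd0
  rw [← hcos]
  nlinarith

end aux

/-- In the CQ setting, `lim_{n→∞} d(T_i x_n, x_n) = 0` for every `i = 1, …, r`. -/
theorem cq_asymptotic_fixed_points
    {H : Type*} [NormedAddCommGroup H] [InnerProductSpace ℝ H]
    -- `C` is a nonempty closed convex subset of the unit sphere `S_H`
    (C : Set H) (hCsphere : ∀ v ∈ C, ‖v‖ = 1)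
    (hCne : C.Nonempty) (hCclosed : IsClosed C) (hCconv : SphConvex C)
    (hCdiam : ∀ v ∈ C, ∀ v' ∈ C, sphDist v v' < Real.pi / 2)
    (a : ℝ) (ha0 : 0 < a) (ha1 : a < 1 / 2)
    (r : ℕ) (hr : 1 ≤ r)
    (α : ℕ → ℕ → ℝ)
    (hα : ∀ n, 1 ≤ n → ∀ i, 1 ≤ i → i ≤ r → α n i ∈ Set.Icc a (1 - a))
    -- `T_1, …, T_r` are nonexpansive self-mappings of `C`
    (T : ℕ → H → H)
    (hTmaps : ∀ i, 1 ≤ i → i ≤ r → ∀ v ∈ C, T i v ∈ C)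
    (hTnonexp : ∀ i, 1 ≤ i → i ≤ r → ∀ v ∈ C, ∀ v' ∈ C,
      sphDist (T i v) (T i v') ≤ sphDist v v')
    -- `F := ⋂ᵢ F(Tᵢ) ≠ ∅`
    (F : Set H)
    (hF : F = ⋂ i ∈ Finset.Icc 1 r, {z ∈ C | T i z = z})
    (hFne : F.Nonempty)
    -- the CQ iteration: `y_n = W_n x_n`, `x_{n+1} = P_{C_n ∩ Q_n} x_1`
    (x y : ℕ → H) (hx1 : x 1 ∈ C)
    (hy : ∀ n, y n = Uiter T (α n) r (x n))
    (CS QS : ℕ → Set H)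
    (hCS : ∀ n, CS n = {z ∈ C | sphDist (y n) z ≤ sphDist (x n) z})
    (hQS : ∀ n, QS n = {z ∈ C |
      Real.cos (sphDist (x 1) z) ≤
        Real.cos (sphDist (x 1) (x n)) * Real.cos (sphDist (x n) z)})
    (hxmem : ∀ n, 1 ≤ n → x (n + 1) ∈ CS n ∩ QS n)
    (hxproj : ∀ n, 1 ≤ n → ∀ z ∈ CS n ∩ QS n,
      sphDist (x 1) (x (n + 1)) ≤ sphDist (x 1) z)
    :
    ∀ i, 1 ≤ i → i ≤ r →
      Tendsto (fun n => sphDist (T i (x n)) (x n)) atTop (𝓝 0) := by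
  -- basic facts
  have hpos : ∀ u ∈ C, ∀ v ∈ C, 0 < inner ℝ u v := fun u hu v hv =>
    Real.arccos_lt_pi_div_two.mp (hCdiam u hu v hv)
  obtain ⟨p, hpF⟩ := hFne
  have hpT : ∀ i, 1 ≤ i → i ≤ r → p ∈ C ∧ T i p = p := by
    intro i h1 h2
    rw [hF] at hpF
    simp only [Set.mem_iInter] at hpF
    exact hpF i (Finset.mem_Icc.mpr ⟨h1, h2⟩)
  have hpC : p ∈ C := (hpT 1 le_rfl hr).1
  have hp1 := hCsphere p hpC
  have hxC : ∀ n, 1 ≤ n → x n ∈ C := by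
    intro n hn
    rcases Nat.lt_or_ge 1 n with h | h
    · obtain ⟨m, rfl⟩ : ∃ m, n = m + 1 := ⟨n - 1, by omega⟩
      have := (hxmem m (by omega)).1
      rw [hCS] at this
      exact this.1
    · have : n = 1 := by omega
      subst this; exact hx1
  -- nonexpansiveness, in inner product form
  have hTin : ∀ i, 1 ≤ i → i ≤ r → ∀ u ∈ C, ∀ v ∈ C,
      inner ℝ u v ≤ inner ℝ (T i u) (T i v) := by
    intro i h1 h2 u hu v hv
    exact (sphDist_le_iff_s8 _ _ _ _ (hCsphere _ (hTmaps i h1 h2 u hu))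
      (hCsphere _ (hTmaps i h1 h2 v hv)) (hCsphere _ hu) (hCsphere _ hv)).mp
      (hTnonexp i h1 h2 u hu v hv)
  have hU : ∀ n, 1 ≤ n → ∀ i, i ≤ r → Uiter T (α n) i (x n) ∈ C ∧
      inner ℝ (x n) p ≤ inner ℝ (Uiter T (α n) i (x n)) p := by
    intro n hn i
    induction i with
    | zero => intro _; exact ⟨hxC n hn, le_rfl⟩
    | succ i ih =>
      intro hi
      obtain ⟨ih1, ih2⟩ := ih (by omega)
      have hα' := hα n hn (i + 1) (by omega) hi
      have hTU := hTmaps (i + 1) (by omega) hi _ ih1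
      have hx := hxC n hn
      refine ⟨hCconv _ hTU _ hx _ ⟨by linarith [hα'.1], by linarith [hα'.2]⟩, ?_⟩
      have h3 := hTin (i + 1) (by omega) hi _ ih1 p hpC
      rw [(hpT (i + 1) (by omega) hi).2] at h3
      have := geo_inner 0 (α n (i + 1)) _ _ p (hCsphere _ hTU) (hCsphere _ hx)
        (hpos _ hTU _ hx) le_rfl (by norm_num) (by linarith [hα'.1]) (by linarith [hα'.2])
        (inner ℝ (x n) p) (hpos _ hx _ hpC).le (ih2.trans h3) le_rfl
      simpa [Uiter] using this
  have hyC : ∀ n, 1 ≤ n → y n ∈ C := fun n hn => by rw [hy]; exact (hU n hn r le_rfl).1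
  have hCSmem : ∀ n, 1 ≤ n → ∀ z, z ∈ CS n ↔ z ∈ C ∧ inner ℝ (x n) z ≤ inner ℝ (y n) z := by
    intro n hn z
    rw [hCS]
    refine and_congr_right fun hz => ?_
    exact sphDist_le_iff_s8 _ _ _ _ (hCsphere _ (hyC n hn)) (hCsphere _ hz)
      (hCsphere _ (hxC n hn)) (hCsphere _ hz)
  have hQSmem : ∀ n, 1 ≤ n → ∀ z, z ∈ QS n ↔ z ∈ C ∧
      inner ℝ (x 1) z ≤ inner ℝ (x 1) (x n) * inner ℝ (x n) z := by
    intro n hn z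
    rw [hQS]
    refine and_congr_right fun hz => ?_
    rw [cos_sphDist_s8 _ _ (hCsphere _ hx1) (hCsphere _ hz),
      cos_sphDist_s8 _ _ (hCsphere _ hx1) (hCsphere _ (hxC n hn)),
      cos_sphDist_s8 _ _ (hCsphere _ (hxC n hn)) (hCsphere _ hz)]
  have hpCS : ∀ n, 1 ≤ n → p ∈ CS n := fun n hn => by
    rw [hCSmem n hn, hy]; exact ⟨hpC, (hU n hn r le_rfl).2⟩
  have hpQS : ∀ n, 1 ≤ n → p ∈ QS n := by
    intro n hn
    induction n, hn using Nat.le_induction with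
    | base =>
      rw [hQSmem 1 le_rfl, real_inner_self_eq_norm_sq, hCsphere _ hx1]
      exact ⟨hpC, by simp⟩
    | succ n hn ih =>
      rw [hQSmem (n + 1) (by omega)]
      refine ⟨hpC, ?_⟩
      have hqC := hxC (n + 1) (by omega)
      apply proj_var _ _ _ (hCsphere _ hqC) hp1 (hpos _ hpC _ hqC)
      intro t ht
      have hzC := hCconv p hpC _ hqC t ht
      refine (sphDist_le_iff_s8 _ _ _ _ (hCsphere _ hx1) (hCsphere _ hqC)
        (hCsphere _ hx1) (hCsphere _ hzC)).mp (hxproj n hn _ ?_)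
      obtain ⟨s, s', hs, hs', he, -⟩ := geo_coeff 0 t p (x (n + 1)) hp1 (hCsphere _ hqC)
        (hpos _ hpC _ hqC) le_rfl (by norm_num) ht.1 (by linarith [ht.2])
      have m1 := (hCSmem n hn _).mp (hpCS n hn)
      have m2 := (hCSmem n hn _).mp (hxmem n hn).1
      have m3 := (hQSmem n hn _).mp ih
      have m4 := (hQSmem n hn _).mp (hxmem n hn).2
      constructor
      · rw [hCSmem n hn]
        refine ⟨hzC, ?_⟩
        rw [he]
        simp only [inner_add_right, real_inner_smul_right]
        have := mul_le_mul_of_nonneg_left m1.2 hs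
        have := mul_le_mul_of_nonneg_left m2.2 hs'
        linarith
      · rw [hQSmem n hn]
        refine ⟨hzC, ?_⟩
        rw [he]
        simp only [inner_add_right, real_inner_smul_right]
        have := mul_le_mul_of_nonneg_left m3.2 hs
        have := mul_le_mul_of_nonneg_left m4.2 hs'
        linarith
  -- convergence of the distances to `x 1`
  set δ := inner ℝ (x 1) p with hδ
  have hδ0 : 0 < δ := hpos _ hx1 _ hpC
  have hb1 : ∀ n, 1 ≤ n → δ ≤ inner ℝ (x 1) (x n) := by
    intro n hn
    have h := ((hQSmem n hn _).mp (hpQS n hn)).2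
    have h1 := (inner_mem _ _ (hCsphere _ (hxC n hn)) hp1).2
    have h2 := hpos _ hx1 _ (hxC n hn)
    nlinarith
  have hb2 : ∀ n, 1 ≤ n → δ ≤ inner ℝ (x n) p := by
    intro n hn
    have h := ((hQSmem n hn _).mp (hpQS n hn)).2
    have h1 := (inner_mem _ _ (hCsphere _ hx1) (hCsphere _ (hxC n hn))).2
    have h2 := hpos _ (hxC n hn) _ hpC
    nlinarith
  have hstep : ∀ n, 1 ≤ n → inner ℝ (x 1) (x (n + 1)) ≤
      inner ℝ (x 1) (x n) * inner ℝ (x n) (x (n + 1)) := fun n hn =>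
    ((hQSmem n hn _).mp (hxmem n hn).2).2
  have hanti : Antitone (fun m : ℕ => (inner ℝ (x 1) (x (m + 1)) : ℝ)) := by
    apply antitone_nat_of_succ_le
    intro m
    have h := hstep (m + 1) (by omega)
    have h1 := (inner_mem _ _ (hCsphere _ (hxC (m + 1) (by omega)))
      (hCsphere _ (hxC (m + 1 + 1) (by omega)))).2
    have h2 := hpos _ hx1 _ (hxC (m + 1) (by omega))
    nlinarith
  have hbdd : BddBelow (Set.range (fun m : ℕ => (inner ℝ (x 1) (x (m + 1)) : ℝ))) :=
    ⟨δ, by rintro _ ⟨m, rfl⟩; exact hb1 (m + 1) (by omega)⟩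
  have hconv := tendsto_atTop_ciInf hanti hbdd
  have hconv' := hconv.comp (tendsto_add_atTop_nat 1)
  have hdiff : Tendsto (fun m : ℕ => (inner ℝ (x 1) (x (m + 1)) : ℝ) - inner ℝ (x 1) (x (m + 2)))
      atTop (𝓝 0) := by
    have := hconv.sub hconv'
    rw [sub_self] at this
    exact this
  have hxx : Tendsto (fun m : ℕ => ‖x (m + 1) - x (m + 2)‖ ^ 2) atTop (𝓝 0) := by
    refine squeeze_zero (fun m => sq_nonneg _) (fun m => ?_)
      (by simpa using hdiff.const_mul (2 / δ))
    have hn : 1 ≤ m + 1 := by omega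
    rw [unit_norm_sub_sq _ _ (hCsphere _ (hxC _ hn)) (hCsphere _ (hxC (m + 2) (by omega)))]
    have h := hstep (m + 1) hn
    have h1 := (inner_mem _ _ (hCsphere _ (hxC (m + 1) hn))
      (hCsphere _ (hxC (m + 1 + 1) (by omega)))).2
    have h2 := hb1 (m + 1) hn
    rw [div_mul_eq_mul_div, le_div_iff₀ hδ0]
    have h3 := mul_le_mul_of_nonneg_right h2 (sub_nonneg.mpr h1)
    linarith
  have hyx : Tendsto (fun m : ℕ => ‖y (m + 1) - x (m + 1)‖) atTop (𝓝 0) := by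
    have hs : Tendsto (fun m : ℕ => ‖x (m + 1) - x (m + 2)‖) atTop (𝓝 0) := by
      have := hxx.sqrt
      simpa [Real.sqrt_sq] using this
    refine squeeze_zero (fun m => norm_nonneg _) (fun m => ?_) (by simpa using hs.add hs)
    have hn : 1 ≤ m + 1 := by omega
    have h := ((hCSmem (m + 1) hn _).mp (hxmem (m + 1) hn).1).2
    have hx2 := hCsphere _ (hxC (m + 2) (by omega))
    have h1 : ‖y (m + 1) - x (m + 2)‖ ≤ ‖x (m + 1) - x (m + 2)‖ := by
      apply le_of_sq_le_sq_aux (norm_nonneg _)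
      rw [unit_norm_sub_sq _ _ (hCsphere _ (hyC _ hn)) hx2,
        unit_norm_sub_sq _ _ (hCsphere _ (hxC _ hn)) hx2]
      linarith
    have h2 := norm_sub_le_norm_sub_add_norm_sub (y (m + 1)) (x (m + 2)) (x (m + 1))
    rw [norm_sub_rev (x (m + 2))] at h2
    linarith
  -- downward induction
  have hk : 0 < 2 * (a * (1 - a)) / Real.pi ^ 2 := by
    have : 0 < 1 - a := by linarith
    have := Real.pi_pos
    positivity
  set k := 2 * (a * (1 - a)) / Real.pi ^ 2 with hkd
  let D : ℕ → ℕ → ℝ := fun i m =>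
    inner ℝ (Uiter T (α (m + 1)) i (x (m + 1))) p - inner ℝ (x (m + 1)) p
  let E : ℕ → ℕ → ℝ := fun i m =>
    ‖T (i + 1) (Uiter T (α (m + 1)) i (x (m + 1))) - x (m + 1)‖
  have hD0 : ∀ i, i ≤ r → ∀ m, 0 ≤ D i m := fun i hi m =>
    sub_nonneg.mpr (hU (m + 1) (by omega) i hi).2
  have hED : ∀ i, i + 1 ≤ r → Tendsto (D (i + 1)) atTop (𝓝 0) → Tendsto (E i) atTop (𝓝 0) := by
    intro i hi hD
    have hs : Tendsto (fun m => E i m ^ 2) atTop (𝓝 0) := by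
      refine squeeze_zero (fun m => sq_nonneg _) (fun m => ?_)
        (by rw [← mul_zero (1 / (k * δ))]; exact hD.const_mul (1 / (k * δ)))
      have hn : 1 ≤ m + 1 := by omega
      obtain ⟨ih1, ih2⟩ := hU (m + 1) hn i (by omega)
      have hα' := hα (m + 1) hn (i + 1) (by omega) hi
      have hTU := hTmaps (i + 1) (by omega) hi _ ih1
      have hx := hxC (m + 1) hn
      have h3 := hTin (i + 1) (by omega) hi _ ih1 p hpC
      rw [(hpT (i + 1) (by omega) hi).2] at h3
      have := geo_inner a (α (m + 1) (i + 1)) _ _ p (hCsphere _ hTU) (hCsphere _ hx)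
        (hpos _ hTU _ hx) ha0.le ha1.le hα'.1 hα'.2
        (inner ℝ (x (m + 1)) p) (hpos _ hx _ hpC).le (ih2.trans h3) le_rfl
      have h4 : (1 + k * E i m ^ 2) * inner ℝ (x (m + 1)) p ≤
        D (i + 1) m + inner ℝ (x (m + 1)) p := by
        simp only [D, sub_add_cancel]
        exact this
      have h5 := hb2 (m + 1) hn
      rw [div_mul_eq_mul_div, le_div_iff₀ (by positivity), one_mul]
      have h6 : k * E i m ^ 2 * δ ≤ k * E i m ^ 2 * inner ℝ (x (m + 1)) p :=
        mul_le_mul_of_nonneg_left h5 (by positivity)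
      linarith
    have := hs.sqrt
    have he : ∀ m, Real.sqrt (E i m ^ 2) = E i m := fun m => Real.sqrt_sq (norm_nonneg _)
    simpa [he] using this
  have hinner_le : ∀ w v : H, inner ℝ w p - inner ℝ v p ≤ ‖w - v‖ := by
    intro w v
    rw [← inner_sub_left]
    have := real_inner_le_norm (w - v) p
    rwa [hp1, mul_one] at this
  have hDE : ∀ i, i + 1 ≤ r → Tendsto (E i) atTop (𝓝 0) → Tendsto (D i) atTop (𝓝 0) := by
    intro i hi hE
    refine squeeze_zero (hD0 i (by omega)) (fun m => ?_) hE
    have hn : 1 ≤ m + 1 := by omega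
    obtain ⟨ih1, ih2⟩ := hU (m + 1) hn i (by omega)
    have h3 := hTin (i + 1) (by omega) hi _ ih1 p hpC
    rw [(hpT (i + 1) (by omega) hi).2] at h3
    have h4 := hinner_le (T (i + 1) (Uiter T (α (m + 1)) i (x (m + 1)))) (x (m + 1))
    simp only [D, E]
    linarith
  have hDall : ∀ j, j ≤ r → Tendsto (D (r - j)) atTop (𝓝 0) := by
    intro j
    induction j with
    | zero =>
      intro _
      refine squeeze_zero (hD0 _ (by omega)) (fun m => ?_) hyx
      have := hinner_le (y (m + 1)) (x (m + 1))
      rw [hy] at this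
      rw [hy]
      exact this
    | succ j ih =>
      intro hj
      have h := ih (by omega)
      have e : r - j = (r - (j + 1)) + 1 := by omega
      rw [e] at h
      exact hDE _ (by omega) (hED _ (by omega) h)
  have hEall : ∀ i, i + 1 ≤ r → Tendsto (E i) atTop (𝓝 0) := by
    intro i hi
    apply hED i hi
    have := hDall (r - (i + 1)) (by omega)
    have e : r - (r - (i + 1)) = i + 1 := by omega
    rwa [e] at this
  have hUx : ∀ i, i + 1 ≤ r →
      Tendsto (fun m => ‖Uiter T (α (m + 1)) i (x (m + 1)) - x (m + 1)‖) atTop (𝓝 0) := by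
    intro i hi
    cases i with
    | zero => simp [Uiter]
    | succ i =>
      refine squeeze_zero (fun m => norm_nonneg _) (fun m => ?_) (hEall i (by omega))
      have hn : 1 ≤ m + 1 := by omega
      have hir : i + 1 ≤ r := by omega
      have ih1 := (hU (m + 1) hn i (by omega)).1
      have ih2 := (hU (m + 1) hn (i + 1) (by omega)).1
      have hα' := hα (m + 1) hn (i + 1) (by omega) hir
      have hTU := hTmaps (i + 1) (by omega) hir _ ih1
      have hx := hxC (m + 1) hn
      have := geo_inner 0 (α (m + 1) (i + 1)) _ _ (x (m + 1)) (hCsphere _ hTU) (hCsphere _ hx)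
        (hpos _ hTU _ hx) le_rfl (by norm_num) (by linarith [hα'.1]) (by linarith [hα'.2])
        _ (hpos _ hTU _ hx).le le_rfl
        (by rw [real_inner_self_eq_norm_sq, hCsphere _ hx, one_pow]
            exact (inner_mem _ _ (hCsphere _ hTU) (hCsphere _ hx)).2)
      simp only [zero_mul, mul_zero, zero_div, add_zero, one_mul] at this
      apply le_of_sq_le_sq_aux (norm_nonneg _)
      rw [unit_norm_sub_sq _ _ (hCsphere _ ih2) (hCsphere _ hx),
        unit_norm_sub_sq _ _ (hCsphere _ hTU) (hCsphere _ hx)]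
      simp only [Uiter]
      linarith
  -- conclusion
  intro i h1 h2
  obtain ⟨i, rfl⟩ : ∃ j, i = j + 1 := ⟨i - 1, by omega⟩
  rw [← tendsto_add_atTop_iff_nat 1]
  have hN : Tendsto (fun m => ‖T (i + 1) (x (m + 1)) - x (m + 1)‖) atTop (𝓝 0) := by
    refine squeeze_zero (fun m => norm_nonneg _) (fun m => ?_)
      (by simpa using (hUx i h2).add (hEall i h2))
    have hn : 1 ≤ m + 1 := by omega
    have hx := hxC (m + 1) hn
    have hu := (hU (m + 1) hn i (by omega)).1
    have h3 : ‖T (i + 1) (x (m + 1)) - T (i + 1) (Uiter T (α (m + 1)) i (x (m + 1)))‖ ≤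
        ‖Uiter T (α (m + 1)) i (x (m + 1)) - x (m + 1)‖ := by
      rw [norm_sub_rev]
      apply le_of_sq_le_sq_aux (norm_nonneg _)
      rw [unit_norm_sub_sq _ _ (hCsphere _ (hTmaps _ h1 h2 _ hu))
        (hCsphere _ (hTmaps _ h1 h2 _ hx)), unit_norm_sub_sq _ _ (hCsphere _ hu) (hCsphere _ hx)]
      linarith [hTin _ h1 h2 _ hu _ hx]
    have h4 := norm_sub_le_norm_sub_add_norm_sub (T (i + 1) (x (m + 1)))
      (T (i + 1) (Uiter T (α (m + 1)) i (x (m + 1)))) (x (m + 1))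
    simp only [E]
    linarith
  have hI : Tendsto (fun m => (inner ℝ (T (i + 1) (x (m + 1))) (x (m + 1)) : ℝ)) atTop (𝓝 1) := by
    have h5 : Tendsto (fun m => 1 - ‖T (i + 1) (x (m + 1)) - x (m + 1)‖ ^ 2 / 2) atTop (𝓝 1) := by
      simpa using ((hN.pow 2).div_const 2).const_sub 1
    refine h5.congr fun m => ?_
    have hx := hxC (m + 1) (by omega)
    rw [unit_norm_sub_sq _ _ (hCsphere _ (hTmaps _ h1 h2 _ hx)) (hCsphere _ hx)]
    ring
  have := (Real.continuous_arccos.tendsto 1).comp hI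
  rw [Real.arccos_one] at this
  exact this
end
end

section
/- Let (X,d) be a metric space, C ⊆ X, and T : C → C a nonexpansive mapping. Let {w_j} be a bounded sequence in C with lim_{j→∞} d(w_j, T w_j) = 0, and let w_∞ ∈ C be such that for every z ∈ C, limsup_{j→∞} d(w_j, w_∞) ≤ limsup_{j→∞} d(w_j, z), with equality holding only when z = w_∞ (i.e., w_∞ is the unique asymptotic center of {w_j} in C). Then T w_∞ = w_∞. -/
open Filter Topology

/-- **Δ-demiclosedness via asymptotic centers.** Let `T : C → C` be a
nonexpansive mapping on a subset `C` of a metric space, `{w_j}` a bounded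
sequence in `C` with `d(w_j, T w_j) → 0`, and let `w∞ ∈ C` be the unique
asymptotic center of `{w_j}` in `C`, i.e. for every `z ∈ C`,
`limsup_j d(w_j, w∞) ≤ limsup_j d(w_j, z)`, with equality only when `z = w∞`.
Then `T w∞ = w∞`. -/
theorem fixed_point_of_asymptotic_center
    {X : Type*} [MetricSpace X] (C : Set X) (T : X → X)
    (hTmaps : ∀ x ∈ C, T x ∈ C)
    (hTnonexp : ∀ x ∈ C, ∀ y ∈ C, dist (T x) (T y) ≤ dist x y)
    (w : ℕ → X) (hw : ∀ j, w j ∈ C)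
    (hbdd : Bornology.IsBounded (Set.range w))
    (hlim : Tendsto (fun j => dist (w j) (T (w j))) atTop (𝓝 0))
    (winf : X) (hwinf : winf ∈ C)
    (hcenter : ∀ z ∈ C,
      limsup (fun j => dist (w j) winf) atTop ≤ limsup (fun j => dist (w j) z) atTop)
    (huniq : ∀ z ∈ C,
      limsup (fun j => dist (w j) winf) atTop = limsup (fun j => dist (w j) z) atTop →
        z = winf) :
    T winf = winf := by
  apply huniq _ (hTmaps _ hwinf)
  apply le_antisymm (hcenter _ (hTmaps _ hwinf))
  have hb : IsBoundedUnder (· ≤ ·) atTop (fun j => dist (w j) winf) := by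
    obtain ⟨r, hr⟩ := hbdd.subset_closedBall winf
    exact isBoundedUnder_of ⟨r, fun j => hr (Set.mem_range_self j)⟩
  have hcob : IsCoboundedUnder (· ≤ ·) atTop (fun j => dist (w j) (T winf)) :=
    IsBoundedUnder.isCoboundedUnder_le (isBoundedUnder_of ⟨0, fun j => dist_nonneg⟩)
  refine le_of_forall_pos_le_add fun ε hε => ?_
  have h1 := eventually_lt_of_limsup_lt
    (lt_add_of_pos_right (limsup (fun j => dist (w j) winf) atTop) (half_pos hε)) hb
  have h2 := hlim.eventually (gt_mem_nhds (half_pos hε))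
  refine limsup_le_of_le hcob ?_
  filter_upwards [h1, h2] with j hj1 hj2
  have h3 := dist_triangle (w j) (T (w j)) (T winf)
  have h4 := hTnonexp _ (hw j) _ hwinf
  linarith
end

section
/- In the shrinking setting described in the context, for every n ∈ ℕ one has F ⊆ C_n; in particular each C_n is a nonempty closed convex subset of C, so the iteration is well defined. -/
open Filter Topology

noncomputable section

open scoped Classical

theorem inner_abs_le_aux {H : Type*} [NormedAddCommGroup H] [InnerProductSpace ℝ H]
    {u v : H} (hu : ‖u‖ = 1) (hv : ‖v‖ = 1) :
    -1 ≤ inner ℝ u v ∧ inner ℝ u v ≤ 1 := by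
  have h := abs_real_inner_le_norm u v
  rw [hu, hv, one_mul] at h
  exact abs_le.mp h

theorem sphDist_le_iff_aux {H : Type*} [NormedAddCommGroup H] [InnerProductSpace ℝ H]
    {u v z : H} (hu : ‖u‖ = 1) (hv : ‖v‖ = 1) (hz : ‖z‖ = 1) :
    sphDist u z ≤ sphDist v z ↔ inner ℝ v z ≤ inner ℝ u z := by
  unfold sphDist
  have h1 := inner_abs_le_aux hu hz
  have h2 := inner_abs_le_aux hv hz
  exact Real.strictAntiOn_arccos.le_iff_ge ⟨h1.1, h1.2⟩ ⟨h2.1, h2.2⟩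

theorem geo_coeffs_aux {H : Type*} [NormedAddCommGroup H] [InnerProductSpace ℝ H]
    {u v : H} (hd : sphDist u v < Real.pi / 2) {t : ℝ} (ht : t ∈ Set.Icc (0 : ℝ) 1) :
    ∃ p q : ℝ, 0 ≤ p ∧ 0 ≤ q ∧ (u = v ∨ sphDist u v = 0 ∨ 1 ≤ p + q) ∧
      (u ≠ v → geo t u v = p • u + q • v) := by
  have h0 : 0 ≤ sphDist u v := Real.arccos_nonneg _
  have hpi := Real.pi_pos
  obtain ⟨ht0, ht1⟩ := ht
  generalize hth : sphDist u v = θ at *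
  have ha : 0 ≤ t * θ := mul_nonneg ht0 h0
  have hb : 0 ≤ (1 - t) * θ := mul_nonneg (by linarith) h0
  have hab : t * θ + (1 - t) * θ = θ := by ring
  have hs0 : 0 ≤ Real.sin θ := Real.sin_nonneg_of_nonneg_of_le_pi h0 (by linarith)
  have hsa : 0 ≤ Real.sin (t * θ) := Real.sin_nonneg_of_nonneg_of_le_pi ha (by linarith)
  have hsb : 0 ≤ Real.sin ((1 - t) * θ) := Real.sin_nonneg_of_nonneg_of_le_pi hb (by linarith)
  refine ⟨Real.sin (t * θ) / Real.sin θ, Real.sin ((1 - t) * θ) / Real.sin θ,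
    div_nonneg hsa hs0, div_nonneg hsb hs0, ?_, ?_⟩
  · right
    rcases h0.eq_or_lt with h | h
    · left; exact h.symm
    · right
      have hs : 0 < Real.sin θ := Real.sin_pos_of_pos_of_lt_pi h (by linarith)
      rw [← add_div, le_div_iff₀ hs, one_mul]
      have e : Real.sin θ = Real.sin (t * θ) * Real.cos ((1 - t) * θ)
          + Real.cos (t * θ) * Real.sin ((1 - t) * θ) := by
        rw [← Real.sin_add, hab]
      rw [e]
      have c1 := Real.cos_le_one ((1 - t) * θ)
      have c2 := Real.cos_le_one (t * θ)
      nlinarith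
  · intro hne
    simp only [geo, if_neg hne, hth]

theorem eq_of_sphDist_zero_aux {H : Type*} [NormedAddCommGroup H] [InnerProductSpace ℝ H]
    {u v : H} (hu : ‖u‖ = 1) (hv : ‖v‖ = 1) (h : sphDist u v = 0) : u = v := by
  have h1 : 1 ≤ inner ℝ u v := Real.arccos_eq_zero.mp h
  exact (inner_eq_one_iff_of_norm_eq_one hu hv).mp (le_antisymm (inner_abs_le_aux hu hv).2 h1)

/-- In the shrinking setting, `F ⊆ C_n` for every `n`; in particular each `C_n`
is a nonempty closed convex subset of `C`, so the iteration is well defined. -/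
theorem shrinking_F_subset_Cn
    {H : Type*} [NormedAddCommGroup H] [InnerProductSpace ℝ H]
    -- `C` is a nonempty closed convex subset of the unit sphere `S_H`
    (C : Set H) (hCsphere : ∀ v ∈ C, ‖v‖ = 1)
    (hCne : C.Nonempty) (hCclosed : IsClosed C) (hCconv : SphConvex C)
    (hCdiam : ∀ v ∈ C, ∀ v' ∈ C, sphDist v v' < Real.pi / 2)
    (a : ℝ) (ha0 : 0 < a) (ha1 : a < 1 / 2)
    (r : ℕ) (hr : 1 ≤ r)
    (α : ℕ → ℕ → ℝ)
    (hα : ∀ n, 1 ≤ n → ∀ i, 1 ≤ i → i ≤ r → α n i ∈ Set.Icc a (1 - a))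
    -- `T_1, …, T_r` are nonexpansive self-mappings of `C`
    (T : ℕ → H → H)
    (hTmaps : ∀ i, 1 ≤ i → i ≤ r → ∀ v ∈ C, T i v ∈ C)
    (hTnonexp : ∀ i, 1 ≤ i → i ≤ r → ∀ v ∈ C, ∀ v' ∈ C,
      sphDist (T i v) (T i v') ≤ sphDist v v')
    -- `F := ⋂ᵢ F(Tᵢ) ≠ ∅`
    (F : Set H)
    (hF : F = ⋂ i ∈ Finset.Icc 1 r, {z ∈ C | T i z = z})
    (hFne : F.Nonempty)
    -- the shrinking iteration: `C_0 = C`, `y_n = W_n x_n`, `x_{n+1} = P_{C_n} x_1`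
    (x y : ℕ → H) (hx1 : x 1 ∈ C)
    (hy : ∀ n, y n = Uiter T (α n) r (x n))
    (CS : ℕ → Set H)
    (hCS0 : CS 0 = C)
    (hCS : ∀ n, 1 ≤ n →
      CS n = {z ∈ C | sphDist (y n) z ≤ sphDist (x n) z} ∩ CS (n - 1))
    (hxmem : ∀ n, 1 ≤ n → x (n + 1) ∈ CS n)
    (hxproj : ∀ n, 1 ≤ n → ∀ z ∈ CS n,
      sphDist (x 1) (x (n + 1)) ≤ sphDist (x 1) z)
    :
    ∀ n, F ⊆ CS n ∧ (CS n).Nonempty ∧ CS n ⊆ C ∧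
      IsClosed (CS n) ∧ SphConvex (CS n) := by
  have hC0 : ∀ u ∈ C, ∀ v ∈ C, 0 ≤ inner ℝ u v := fun u hu v hv =>
    (Real.arccos_lt_pi_div_two.mp (hCdiam u hu v hv)).le
  have hFm : ∀ z ∈ F, ∀ i, 1 ≤ i → i ≤ r → z ∈ C ∧ T i z = z := by
    intro z hz i h1 h2
    rw [hF] at hz
    exact Set.mem_iInter₂.mp hz i (Finset.mem_Icc.mpr ⟨h1, h2⟩)
  have hFC : F ⊆ C := fun z hz => (hFm z hz 1 le_rfl hr).1
  have hU : ∀ n, 1 ≤ n → ∀ w ∈ C, ∀ i, i ≤ r → Uiter T (α n) i w ∈ C ∧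
      ∀ z ∈ F, inner ℝ w z ≤ inner ℝ (Uiter T (α n) i w) z := by
    intro n hn w hw i
    induction i with
    | zero => intro _; exact ⟨hw, fun z _ => le_rfl⟩
    | succ i ih =>
      intro hi
      obtain ⟨hm, hin⟩ := ih (by omega)
      have hTm := hTmaps (i + 1) (by omega) hi _ hm
      have hαi := hα n hn (i + 1) (by omega) hi
      have ht : α n (i + 1) ∈ Set.Icc (0 : ℝ) 1 :=
        ⟨by linarith [hαi.1], by linarith [hαi.2]⟩
      refine ⟨hCconv _ hTm _ hw _ ht, ?_⟩
      intro z hz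
      obtain ⟨hzC, hTz⟩ := hFm z hz (i + 1) (by omega) hi
      have hTi : inner ℝ w z ≤ inner ℝ (T (i + 1) (Uiter T (α n) i w)) z := by
        have h := hTnonexp (i + 1) (by omega) hi _ hm z hzC
        rw [hTz, sphDist_le_iff_aux (hCsphere _ hTm) (hCsphere _ hm) (hCsphere _ hzC)] at h
        exact (hin z hz).trans h
      change inner ℝ w z ≤
        inner ℝ (geo (α n (i + 1)) (T (i + 1) (Uiter T (α n) i w)) w) z
      generalize T (i + 1) (Uiter T (α n) i w) = u at *
      by_cases huw : u = w
      · subst huw; simp [geo]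
      · obtain ⟨p, q, hp, hq, hpq, hg⟩ := geo_coeffs_aux (hCdiam u hTm w hw) ht
        have hpq1 : 1 ≤ p + q := by
          rcases hpq with h | h | h
          · exact absurd h huw
          · exact absurd (eq_of_sphDist_zero_aux (hCsphere _ hTm) (hCsphere _ hw) h) huw
          · exact h
        rw [hg huw, inner_add_left, real_inner_smul_left, real_inner_smul_left]
        have := hC0 w hw z hzC
        nlinarith [mul_le_mul_of_nonneg_left hTi hp, mul_le_mul_of_nonneg_right hpq1 this]
  intro n
  induction n with
  | zero => rw [hCS0]; exact ⟨hFC, hCne, subset_rfl, hCclosed, hCconv⟩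
  | succ n ih =>
    obtain ⟨iF, -, iC, icl, icv⟩ := ih
    have hxC : x (n + 1) ∈ C := by
      rcases Nat.eq_zero_or_pos n with h | h
      · subst h; exact hx1
      · exact iC (hxmem n h)
    have hyC : y (n + 1) ∈ C := by
      rw [hy]; exact (hU (n + 1) (by omega) _ hxC r le_rfl).1
    have e := hCS (n + 1) (by omega)
    rw [Nat.add_sub_cancel] at e
    have hFsub : F ⊆ CS (n + 1) := by
      intro z hz
      rw [e]
      refine ⟨⟨hFC hz, ?_⟩, iF hz⟩
      rw [sphDist_le_iff_aux (hCsphere _ hyC) (hCsphere _ hxC) (hCsphere _ (hFC hz)), hy]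
      exact (hU (n + 1) (by omega) _ hxC r le_rfl).2 z hz
    refine ⟨hFsub, hFne.mono hFsub, ?_, ?_, ?_⟩
    · rw [e]; exact fun z hz => hz.1.1
    · rw [e]
      have hc : ∀ c : H, Continuous (fun z : H => sphDist c z) := fun c =>
        Real.continuous_arccos.comp (continuous_const.inner continuous_id)
      have hcl : IsClosed {z : H | sphDist (y (n + 1)) z ≤ sphDist (x (n + 1)) z} :=
        isClosed_le (hc _) (hc _)
      exact IsClosed.inter (hCclosed.inter hcl) icl
    · rw [e]
      rintro v ⟨⟨hv, hvd⟩, hv'⟩ w ⟨⟨hw, hwd⟩, hw'⟩ t ht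
      have hgC := hCconv v hv w hw t ht
      refine ⟨⟨hgC, ?_⟩, icv v hv' w hw' t ht⟩
      rw [sphDist_le_iff_aux (hCsphere _ hyC) (hCsphere _ hxC) (hCsphere _ hgC)]
      rw [sphDist_le_iff_aux (hCsphere _ hyC) (hCsphere _ hxC) (hCsphere _ hv)] at hvd
      rw [sphDist_le_iff_aux (hCsphere _ hyC) (hCsphere _ hxC) (hCsphere _ hw)] at hwd
      by_cases hvw : v = w
      · subst hvw; simpa [geo] using hvd
      · obtain ⟨p, q, hp, hq, -, hg⟩ := geo_coeffs_aux (hCdiam v hv w hw) ht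
        rw [hg hvw]
        simp only [inner_add_right, real_inner_smul_right]
        exact add_le_add (mul_le_mul_of_nonneg_left hvd hp) (mul_le_mul_of_nonneg_left hwd hq)
end
end
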